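/- arXiv:0802.0512 — 12 statements merged into one kernel-verified Lean document; each statement's English description precedes it below -/
import Mathlib

section
/- Let g ∈ SL(2,ℝ) act on the hyperbolic plane ℍ, and suppose that Min(g) is nonempty (i.e. the displacement infimum ℓ(g) is attained; this holds exactly when g is not parabolic). Then for every r > 0 there exists k > 0 such that every x ∈ ℍ with dist x (g • x) < ℓ(g) + r satisfies Metric.infDist x (Min g) < k. (Lemma 2.1 of the paper, in the case n = 2.) -/
open scoped MatrixGroups UpperHalfPlane

/-- The translation/displacement infimum of `g` acting on the hyperbolic plane. -/
noncomputable def ell (g : SL(2, ℝ)) : ℝ :=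
  ⨅ y : ℍ, dist y (g • y)

/-- The set of points realizing the displacement infimum of `g`. -/
noncomputable def MinSet (g : SL(2, ℝ)) : Set ℍ :=
  {y : ℍ | dist y (g • y) = ell g}

/-- The real quadratic form `c|z|² + (d - a) Re z - b` attached to `g = !![a, b; c, d]`. -/
def fixedForm (g : SL(2, ℝ)) (z : ℍ) : ℝ :=
  g 1 0 * (z.re ^ 2 + z.im ^ 2) + (g 1 1 - g 0 0) * z.re - g 0 1

/-- The discriminant `(d - a)² + 4bc = (Tr g)² - 4` of the fixed point equation of `g`. -/
def fixedDiscr (g : SL(2, ℝ)) : ℝ :=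
  (g 1 1 - g 0 0) ^ 2 + 4 * g 0 1 * g 1 0

lemma four_mul_sinh_half_dist_sq_mul (z w : ℍ) :
    4 * Real.sinh (dist z w / 2) ^ 2 * (z.im * w.im) =
      (z.re - w.re) ^ 2 + (z.im - w.im) ^ 2 := by
  have hpos : 0 < z.im * w.im := mul_pos z.im_pos w.im_pos
  have hd : dist (z : ℂ) w ^ 2 = (z.re - w.re) ^ 2 + (z.im - w.im) ^ 2 := by
    rw [Complex.dist_eq_re_im, Real.sq_sqrt (by positivity)]
    simp
  rw [UpperHalfPlane.sinh_half_dist, div_pow, mul_pow, Real.sq_sqrt hpos.le, hd]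
  field_simp
  ring

lemma UpperHalfPlane.dist_le_of_sq_le {z w : ℍ} {K : ℝ} (hK : 0 ≤ K)
    (h : (z.re - w.re) ^ 2 + (z.im - w.im) ^ 2 ≤ K ^ 2 * (z.im * w.im)) : dist z w ≤ K := by
  have hpos : 0 < z.im * w.im := mul_pos z.im_pos w.im_pos
  rw [← four_mul_sinh_half_dist_sq_mul] at h
  have h1 : 4 * Real.sinh (dist z w / 2) ^ 2 ≤ K ^ 2 := le_of_mul_le_mul_right h hpos
  have h2 : 2 * Real.sinh (dist z w / 2) ≤ K := abs_le_of_sq_le_sq' (by linarith) hK |>.2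
  have h3 := Real.self_le_sinh_iff.2 (by positivity : 0 ≤ dist z w / 2)
  linarith

/-- The displacement of `g` at `z` in terms of `fixedForm` and `fixedDiscr`. -/
lemma four_mul_sinh_half_displacement_sq_mul (g : SL(2, ℝ)) (z : ℍ) :
    4 * Real.sinh (dist z (g • z) / 2) ^ 2 * z.im ^ 2 =
      fixedForm g z ^ 2 + fixedDiscr g * z.im ^ 2 := by
  have hS := four_mul_sinh_half_dist_sq_mul z (g • z)
  have hdet : g 0 0 * g 1 1 - g 0 1 * g 1 0 = 1 := by
    rw [← Matrix.det_fin_two]; exact g.det_coe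
  have hy := z.im_pos
  have hn : 0 < (g 1 0 * z.re + g 1 1) ^ 2 + (g 1 0 * z.im) ^ 2 := by
    rcases eq_or_ne (g 1 0) 0 with hc | hc
    · have hd : g 1 1 ≠ 0 := by rintro hd; simp [hc, hd] at hdet
      simp only [hc, zero_mul, zero_add]
      positivity
    · positivity
  have hN : Complex.normSq (g 1 0 * (z : ℂ) + g 1 1) =
      (g 1 0 * z.re + g 1 1) ^ 2 + (g 1 0 * z.im) ^ 2 := by
    simp [Complex.normSq_apply]
    ring
  have hre : (g • z).re * ((g 1 0 * z.re + g 1 1) ^ 2 + (g 1 0 * z.im) ^ 2) =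
      (g 0 0 * z.re + g 0 1) * (g 1 0 * z.re + g 1 1) + g 0 0 * g 1 0 * z.im ^ 2 := by
    rw [← UpperHalfPlane.coe_re, UpperHalfPlane.coe_specialLinearGroup_apply, Complex.div_re]
    simp only [Algebra.algebraMap_self, RingHom.id_apply]
    rw [hN, ← add_div, div_mul_cancel₀ _ hn.ne']
    simp
    ring
  have him : (g • z).im * ((g 1 0 * z.re + g 1 1) ^ 2 + (g 1 0 * z.im) ^ 2) = z.im := by
    rw [← UpperHalfPlane.coe_im, UpperHalfPlane.coe_specialLinearGroup_apply, Complex.div_im]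
    simp only [Algebra.algebraMap_self, RingHom.id_apply]
    rw [hN, ← sub_div, div_mul_cancel₀ _ hn.ne']
    simp
    linear_combination z.im * hdet
  simp only [fixedForm, fixedDiscr]
  generalize 4 * Real.sinh (dist z (g • z) / 2) ^ 2 = S at *
  generalize (g • z).re = X at *
  generalize (g • z).im = Y at *
  generalize z.re = x at *
  generalize z.im = y at *
  generalize (g 0 0 : ℝ) = a at *
  generalize (g 0 1 : ℝ) = b at *
  generalize (g 1 0 : ℝ) = c at *
  generalize (g 1 1 : ℝ) = d at *
  obtain ⟨n, hn'⟩ : ∃ n, n = (c * x + d) ^ 2 + (c * y) ^ 2 := ⟨_, rfl⟩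
  rw [← hn'] at hn hre him
  apply mul_right_cancel₀ hn.ne'
  have h1 : S * y ^ 2 * n = (n * x - X * n) ^ 2 + (n * y - Y * n) ^ 2 := by
    have : S * y ^ 2 * n = S * (y * Y) * n ^ 2 := by linear_combination -S * y * n * him
    rw [this, hS]; ring
  rw [h1, hre, him]
  have h2 : n * y - y = n * y - (a * d - b * c) * y := by rw [hdet]; ring
  rw [h2, hn']
  ring

lemma ell_le_dist_smul (g : SL(2, ℝ)) (z : ℍ) : ell g ≤ dist z (g • z) :=
  ciInf_le ⟨0, by rintro _ ⟨y, rfl⟩; exact dist_nonneg⟩ z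

lemma mem_MinSet_of_forall_dist_le {g : SL(2, ℝ)} {w : ℍ}
    (h : ∀ z : ℍ, dist w (g • w) ≤ dist z (g • z)) : w ∈ MinSet g :=
  le_antisymm (le_ciInf h) (ell_le_dist_smul g w)

/-- Displacements are compared by the values of `fixedForm` divided by the imaginary part. -/
lemma dist_smul_le_dist_smul_iff (g : SL(2, ℝ)) (w z : ℍ) :
    dist w (g • w) ≤ dist z (g • z) ↔
      (fixedForm g w / w.im) ^ 2 ≤ (fixedForm g z / z.im) ^ 2 := by
  have key (z : ℍ) : (fixedForm g z / z.im) ^ 2 =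
      4 * Real.sinh (dist z (g • z) / 2) ^ 2 - fixedDiscr g := by
    have := four_mul_sinh_half_displacement_sq_mul g z
    have hz := z.im_pos
    field_simp
    linarith
  have hs (z : ℍ) : 0 ≤ Real.sinh (dist z (g • z) / 2) :=
    Real.sinh_nonneg_iff.2 (by positivity)
  rw [key, key, sub_le_sub_iff_right, mul_le_mul_iff_right₀ (by norm_num),
    pow_le_pow_iff_left₀ (hs w) (hs z) two_ne_zero, Real.sinh_le_sinh]
  constructor <;> intro h <;> linarith

lemma mem_MinSet_of_fixedForm_eq_zero {g : SL(2, ℝ)} {w : ℍ} (h : fixedForm g w = 0) :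
    w ∈ MinSet g :=
  mem_MinSet_of_forall_dist_le fun z ↦ by
    rw [dist_smul_le_dist_smul_iff, h]
    simpa using sq_nonneg _

lemma exists_abs_fixedForm_le (g : SL(2, ℝ)) (R : ℝ) :
    ∃ M : ℝ, 0 < M ∧ ∀ z : ℍ, dist z (g • z) < R → |fixedForm g z| ≤ M * z.im := by
  refine ⟨√(4 * Real.sinh (R / 2) ^ 2 + |fixedDiscr g|) + 1, by positivity, fun z hz ↦ ?_⟩
  have hy := z.im_pos
  have hs : Real.sinh (dist z (g • z) / 2) ^ 2 ≤ Real.sinh (R / 2) ^ 2 :=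
    pow_le_pow_left₀ (Real.sinh_nonneg_iff.2 (by positivity)) (Real.sinh_le_sinh.2 (by linarith)) 2
  have h1 : |fixedForm g z| ≤ √(4 * Real.sinh (R / 2) ^ 2 + |fixedDiscr g|) * z.im := by
    apply abs_le_of_sq_le_sq _ (by positivity)
    rw [mul_pow, Real.sq_sqrt (by positivity)]
    have := four_mul_sinh_half_displacement_sq_mul g z
    have h2 : fixedForm g z ^ 2 =
        (4 * Real.sinh (dist z (g • z) / 2) ^ 2 - fixedDiscr g) * z.im ^ 2 := by linarith
    rw [h2]
    gcongr
    linarith [neg_abs_le (fixedDiscr g)]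
  linarith

/-- Completing the square in `fixedForm`. -/
lemma fixedForm_eq_of_ne_zero {g : SL(2, ℝ)} (hc : g 1 0 ≠ 0) (z : ℍ) :
    fixedForm g z = g 1 0 * ((z.re + (g 1 1 - g 0 0) / (2 * g 1 0)) ^ 2 + z.im ^ 2 -
      fixedDiscr g / (2 * g 1 0) ^ 2) := by
  simp only [fixedForm, fixedDiscr]
  field_simp
  ring

/-- In the elliptic case the sublevel sets of `fixedForm` are bounded. -/
lemma exists_dist_le_of_fixedDiscr_neg {g : SL(2, ℝ)} (hD : fixedDiscr g < 0) {M : ℝ}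
    (hM : 0 < M) :
    ∃ (p : ℍ) (K : ℝ), ∀ z : ℍ, |fixedForm g z| ≤ M * z.im → dist z p ≤ K := by
  have hc : g 1 0 ≠ 0 := by
    intro hc
    simp only [fixedDiscr, hc] at hD
    nlinarith [sq_nonneg (g 1 1 - g 0 0)]
  have hE : 0 < -fixedDiscr g / (2 * g 1 0) ^ 2 := div_pos (by linarith) (by positivity)
  set q := √(-fixedDiscr g / (2 * g 1 0) ^ 2)
  have hq0 : 0 < q := Real.sqrt_pos.2 hE
  have hq2 : q ^ 2 = -fixedDiscr g / (2 * g 1 0) ^ 2 := Real.sq_sqrt hE.le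
  refine ⟨⟨⟨-((g 1 1 - g 0 0) / (2 * g 1 0)), q⟩, hq0⟩, √(M / (|g 1 0| * q)), fun z hz ↦ ?_⟩
  apply UpperHalfPlane.dist_le_of_sq_le (by positivity)
  have hy := z.im_pos
  rw [fixedForm_eq_of_ne_zero hc, abs_mul, sub_eq_add_neg, ← neg_div, ← hq2,
    abs_of_nonneg (by positivity : 0 ≤ (z.re + (g 1 1 - g 0 0) / (2 * g 1 0)) ^ 2 + z.im ^ 2 +
      q ^ 2)] at hz
  rw [Real.sq_sqrt (by positivity)]
  simp only [UpperHalfPlane.mk_re, UpperHalfPlane.mk_im, sub_neg_eq_add]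
  have hc' : 0 < |g 1 0| := abs_pos.2 hc
  have : M / (|g 1 0| * q) * (z.im * q) = M * z.im / |g 1 0| := by field_simp
  rw [this, le_div_iff₀ hc']
  nlinarith [mul_pos hc' (mul_pos hy hq0)]

/-- In the hyperbolic case the sublevel sets of `fixedForm` are close to its zero set. -/
lemma exists_fixedForm_eq_zero_of_fixedDiscr_pos {g : SL(2, ℝ)} (hD : 0 < fixedDiscr g) {M : ℝ}
    (hM : 0 < M) :
    ∃ K : ℝ, ∀ z : ℍ, |fixedForm g z| ≤ M * z.im → ∃ w, fixedForm g w = 0 ∧ dist z w ≤ K := by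
  by_cases hc : g 1 0 = 0
  · have hd : g 1 1 - g 0 0 ≠ 0 := by
      intro hd
      simp [fixedDiscr, hc, hd] at hD
    refine ⟨M / |g 1 1 - g 0 0|, fun z hz ↦
      ⟨⟨⟨g 0 1 / (g 1 1 - g 0 0), z.im⟩, z.im_pos⟩, ?_, ?_⟩⟩
    · simp only [fixedForm, hc, UpperHalfPlane.mk_re, UpperHalfPlane.mk_im]
      field_simp
      ring
    · apply UpperHalfPlane.dist_le_of_sq_le (by positivity)
      simp only [UpperHalfPlane.mk_re, UpperHalfPlane.mk_im]
      have h : fixedForm g z = (g 1 1 - g 0 0) * (z.re - g 0 1 / (g 1 1 - g 0 0)) := by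
        simp only [fixedForm, hc]
        field_simp
        ring
      have hd' := abs_pos.2 hd
      have h1 : |z.re - g 0 1 / (g 1 1 - g 0 0)| ≤ M / |g 1 1 - g 0 0| * z.im := by
        rw [h, abs_mul] at hz
        rw [div_mul_eq_mul_div, le_div_iff₀ hd']
        linarith
      have h2 := sq_le_sq' (abs_le.1 h1).1 (abs_le.1 h1).2
      linarith
  · have hE : 0 < fixedDiscr g / (2 * g 1 0) ^ 2 := by positivity
    have hR0 : 0 < √(fixedDiscr g / (2 * g 1 0) ^ 2) := Real.sqrt_pos.2 hE
    have hR2 := Real.sq_sqrt hE.le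
    have hF := fixedForm_eq_of_ne_zero hc
    rw [← hR2] at hF
    generalize √(fixedDiscr g / (2 * g 1 0) ^ 2) = R at hR0 hF
    generalize (g 1 1 - g 0 0) / (2 * g 1 0) = m at hF
    have hc' : 0 < |g 1 0| := abs_pos.2 hc
    refine ⟨M / (|g 1 0| * R), fun z hz ↦ ?_⟩
    have hy := z.im_pos
    have hu : 0 < (z.re + m) ^ 2 + z.im ^ 2 := by positivity
    obtain ⟨ρ, hρ, hρ2⟩ : ∃ ρ : ℝ, 0 < ρ ∧ ρ ^ 2 = (z.re + m) ^ 2 + z.im ^ 2 :=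
      ⟨_, Real.sqrt_pos.2 hu, Real.sq_sqrt hu.le⟩
    refine ⟨⟨⟨-m + R / ρ * (z.re + m), R / ρ * z.im⟩, by positivity⟩, ?_, ?_⟩
    · rw [hF]
      simp only [UpperHalfPlane.mk_re, UpperHalfPlane.mk_im]
      have : (-m + R / ρ * (z.re + m) + m) ^ 2 + (R / ρ * z.im) ^ 2 = R ^ 2 := by
        have : (-m + R / ρ * (z.re + m) + m) ^ 2 + (R / ρ * z.im) ^ 2 =
          (R / ρ) ^ 2 * ((z.re + m) ^ 2 + z.im ^ 2) := by ring
        rw [this, ← hρ2]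
        field_simp
      rw [this]
      ring
    · apply UpperHalfPlane.dist_le_of_sq_le (by positivity)
      simp only [UpperHalfPlane.mk_re, UpperHalfPlane.mk_im]
      rw [hF, abs_mul, ← hρ2] at hz
      have h1 : |ρ ^ 2 - R ^ 2| ≤ M / |g 1 0| * z.im := by
        rw [div_mul_eq_mul_div, le_div_iff₀ hc']
        linarith
      have h2 := sq_le_sq' (abs_le.1 h1).1 (abs_le.1 h1).2
      have h3 : (z.re - (-m + R / ρ * (z.re + m))) ^ 2 + (z.im - R / ρ * z.im) ^ 2 =
          (ρ - R) ^ 2 := by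
        have : (z.re - (-m + R / ρ * (z.re + m))) ^ 2 + (z.im - R / ρ * z.im) ^ 2 =
          (1 - R / ρ) ^ 2 * ((z.re + m) ^ 2 + z.im ^ 2) := by ring
        rw [this, ← hρ2]
        field_simp
      have h4 : (M / (|g 1 0| * R)) ^ 2 * (z.im * (R / ρ * z.im)) =
          (M / |g 1 0| * z.im) ^ 2 / (R * ρ) := by field_simp
      rw [h3, h4, le_div_iff₀ (by positivity)]
      refine le_trans ?_ h2
      have h5 : (ρ ^ 2 - R ^ 2) ^ 2 = (ρ - R) ^ 2 * (ρ + R) ^ 2 := by ring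
      rw [h5]
      gcongr
      nlinarith [mul_pos hR0 hρ]

/-- In the parabolic case the displacement infimum is attained only by `±1`. -/
lemma fixedForm_eq_zero_of_fixedDiscr_eq_zero {g : SL(2, ℝ)} (hD : fixedDiscr g = 0)
    (hmin : (MinSet g).Nonempty) (z : ℍ) : fixedForm g z = 0 := by
  obtain ⟨m, hm⟩ := hmin
  have hy := m.im_pos
  have hle (z : ℍ) : (fixedForm g m / m.im) ^ 2 ≤ (fixedForm g z / z.im) ^ 2 := by
    rw [← dist_smul_le_dist_smul_iff, show dist m (g • m) = ell g from hm]
    exact ell_le_dist_smul g z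
  by_cases hc : g 1 0 = 0
  · have hd : g 1 1 - g 0 0 = 0 := by simpa [fixedDiscr, hc] using hD
    have h := hle ⟨⟨0, 2 * m.im⟩, by positivity⟩
    simp only [fixedForm, hc, hd, UpperHalfPlane.mk_im, div_pow, mul_pow, zero_mul, zero_add,
      zero_sub] at h ⊢
    rw [div_le_div_iff₀ (by positivity) (by positivity)] at h
    have : g 0 1 ^ 2 * m.im ^ 2 ≤ 0 := by nlinarith
    have : g 0 1 ^ 2 ≤ 0 := nonpos_of_mul_nonpos_left this (by positivity)
    simpa using le_antisymm this (sq_nonneg _)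
  · exfalso
    have h := hle ⟨⟨-((g 1 1 - g 0 0) / (2 * g 1 0)), m.im / 2⟩, by positivity⟩
    rw [fixedForm_eq_of_ne_zero hc, fixedForm_eq_of_ne_zero hc, hD] at h
    simp only [UpperHalfPlane.mk_re, UpperHalfPlane.mk_im, neg_add_cancel, zero_div, sub_zero,
      mul_div_assoc, mul_pow] at h
    have h1 := le_of_mul_le_mul_left h (by positivity)
    have h2 := abs_le_of_sq_le_sq h1 (by positivity)
    rw [abs_of_nonneg (by positivity), div_le_div_iff₀ (by positivity) (by positivity)] at h2
    nlinarith [mul_nonneg (sq_nonneg (m.re + (g 1 1 - g 0 0) / (2 * g 1 0))) hy.le,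
      pow_pos hy 3]

/-- Lemma 2.1 of the paper (case n = 2): if `Min(g)` is nonempty, then for every `r > 0`
the set of points displaced by less than `ℓ(g) + r` stays at bounded distance from `Min(g)`. -/
theorem min_r_bounded_distance_from_min (g : SL(2, ℝ)) (hmin : (MinSet g).Nonempty) :
    ∀ r : ℝ, 0 < r → ∃ k : ℝ, 0 < k ∧ ∀ x : ℍ,
      dist x (g • x) < ell g + r → Metric.infDist x (MinSet g) < k := by
  intro r _
  suffices h : ∃ K : ℝ, ∀ x : ℍ, dist x (g • x) < ell g + r → ∃ w ∈ MinSet g, dist x w ≤ K by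
    obtain ⟨K, hK⟩ := h
    refine ⟨|K| + 1, by positivity, fun x hx ↦ ?_⟩
    obtain ⟨w, hw, hxw⟩ := hK x hx
    linarith [Metric.infDist_le_dist_of_mem (x := x) hw, le_abs_self K]
  obtain ⟨M, hM, hF⟩ := exists_abs_fixedForm_le g (ell g + r)
  rcases lt_trichotomy (fixedDiscr g) 0 with hD | hD | hD
  · obtain ⟨p, K, hK⟩ := exists_dist_le_of_fixedDiscr_neg hD hM
    obtain ⟨m, hm⟩ := hmin
    exact ⟨K + dist p m, fun x hx ↦ ⟨m, hm, (dist_triangle x p m).trans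
      (add_le_add_left (hK x (hF x hx)) _)⟩⟩
  · exact ⟨0, fun x _ ↦ ⟨x, mem_MinSet_of_fixedForm_eq_zero
      (fixedForm_eq_zero_of_fixedDiscr_eq_zero hD hmin x), (dist_self x).le⟩⟩
  · obtain ⟨K, hK⟩ := exists_fixedForm_eq_zero_of_fixedDiscr_pos hD hM
    refine ⟨K, fun x hx ↦ ?_⟩
    obtain ⟨w, hw, hxw⟩ := hK x (hF x hx)
    exact ⟨w, mem_MinSet_of_fixedForm_eq_zero hw, hxw⟩
end

section
/- Let g ∈ SL(2,ℝ) with |Tr g| > 2 (a hyperbolic isometry of ℍ). Then Min(g) is nonempty, and for every x ∈ ℍ one has cosh (dist x (g • x)) ≥ 1 + (cosh (ℓ g) − 1) · (cosh (Metric.infDist x (Min g)))². (The hyperbolic cosine-law estimate from the proof of Lemma 2.1.) -/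
open scoped MatrixGroups UpperHalfPlane

/-- Orthogonal projection onto the geodesic `α |w|² + β Re w + γ = 0` in the upper half-plane,
with the distance to it. -/
theorem exists_mem_geodesic_cosh_dist_sq_eq (α β γ : ℝ) (h : 0 < β ^ 2 - 4 * α * γ) (z : ℍ) :
    ∃ w : ℍ, α * (w.re ^ 2 + w.im ^ 2) + β * w.re + γ = 0 ∧
      Real.cosh (dist z w) ^ 2 = 1 + (α * (z.re ^ 2 + z.im ^ 2) + β * z.re + γ) ^ 2 /
        ((β ^ 2 - 4 * α * γ) * z.im ^ 2) := by
  have hy : 0 < z.im := z.im_pos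
  set x := z.re
  set y := z.im
  obtain ⟨D, hD⟩ : ∃ D, D = β ^ 2 - 4 * α * γ := ⟨_, rfl⟩
  obtain ⟨N, hN⟩ : ∃ N, N = α * (x ^ 2 + y ^ 2) + β * x + γ := ⟨_, rfl⟩
  obtain ⟨P, hP⟩ : ∃ P, P = 2 * x * β ^ 2 - 4 * γ * β - 8 * α * γ * x
      - 2 * β * (α * (x ^ 2 + y ^ 2) + β * x - γ) := ⟨_, rfl⟩
  obtain ⟨T, hT⟩ : ∃ T, T = (2 * α * x + β) ^ 2 + 4 * α ^ 2 * y ^ 2 + D := ⟨_, rfl⟩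
  rw [← hD, ← hN]
  rw [← hD] at h
  have hT0 : 0 < T := by rw [hT]; positivity
  obtain ⟨s, hs, hs2⟩ : ∃ s, 0 < s ∧ s ^ 2 = D := ⟨√D, Real.sqrt_pos.2 h, Real.sq_sqrt h.le⟩
  have hK0 : 0 < N ^ 2 + D * y ^ 2 := by positivity
  obtain ⟨K, hK, hK2⟩ : ∃ K, 0 < K ∧ K ^ 2 = N ^ 2 + D * y ^ 2 :=
    ⟨_, Real.sqrt_pos.2 hK0, Real.sq_sqrt hK0.le⟩
  have e1 : α * (P ^ 2 + 4 * D * K ^ 2) + β * P * T + γ * T ^ 2 = 0 := by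
    rw [hK2, hT, hP, hN, hD]; ring
  have e2 : (x * T - P) ^ 2 + y ^ 2 * T ^ 2 + 4 * D * K ^ 2 = 4 * K ^ 2 * T := by
    rw [hK2, hT, hP, hN, hD]; ring
  refine ⟨⟨⟨P / T, 2 * s * K / T⟩, by positivity⟩, ?_, ?_⟩
  · change α * ((P / T) ^ 2 + (2 * s * K / T) ^ 2) + β * (P / T) + γ = 0
    rw [← hs2] at e1
    field_simp
    linear_combination e1
  · have hc : Real.cosh (dist z ⟨⟨P / T, 2 * s * K / T⟩, by positivity⟩) = K / (s * y) := by
      rw [UpperHalfPlane.cosh_dist']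
      change ((x - P / T) ^ 2 + y ^ 2 + (2 * s * K / T) ^ 2) / (2 * y * (2 * s * K / T)) = _
      rw [← hs2] at e2
      field_simp
      linear_combination e2
    rw [hc, div_pow, mul_pow, hs2, hK2]
    field_simp
    ring

/-- The displacement of `g`, in terms of the quadratic form vanishing on its axis. -/
theorem cosh_dist_smul (g : SL(2, ℝ)) (z : ℍ) :
    Real.cosh (dist z (g • z)) = 1 + ((g 1 1 - g 0 0) ^ 2 - 4 * g 1 0 * -g 0 1) / 2 +
      (g 1 0 * (z.re ^ 2 + z.im ^ 2) + (g 1 1 - g 0 0) * z.re + -g 0 1) ^ 2 /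
        (2 * z.im ^ 2) := by
  have hy : 0 < z.im := z.im_pos
  have hden : (g 1 0 : ℂ) * z + g 1 1 ≠ 0 := UpperHalfPlane.denom_ne_zero g z
  have hn : 0 < Complex.normSq ((g 1 0 : ℂ) * z + g 1 1) := Complex.normSq_pos.2 hden
  have him : (g • z).im = z.im / Complex.normSq ((g 1 0 : ℂ) * z + g 1 1) :=
    (UpperHalfPlane.im_smul_eq_div_normSq (g : GL (Fin 2) ℝ) z).trans
      (by simp [UpperHalfPlane.denom])
  have hco : ((g • z : ℍ) : ℂ) = ((g 0 0 : ℂ) * z + g 0 1) / ((g 1 0 : ℂ) * z + g 1 1) := by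
    simpa using UpperHalfPlane.coe_specialLinearGroup_apply g z
  have hd : dist (z : ℂ) (g • z : ℍ) ^ 2 =
      Complex.normSq (z * ((g 1 0 : ℂ) * z + g 1 1) - ((g 0 0 : ℂ) * z + g 0 1)) /
        Complex.normSq ((g 1 0 : ℂ) * z + g 1 1) := by
    rw [Complex.dist_eq, Complex.sq_norm, hco, ← Complex.normSq_div, sub_div,
      mul_div_cancel_right₀ _ hden]
  rw [UpperHalfPlane.cosh_dist, hd, him]
  generalize Complex.normSq ((g 1 0 : ℂ) * z + g 1 1) = M at hn
  field_simp
  simp only [Complex.normSq_apply, Complex.add_re, Complex.sub_re, Complex.mul_re, Complex.add_im,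
    Complex.sub_im, Complex.mul_im, Complex.ofReal_re, Complex.ofReal_im, UpperHalfPlane.coe_re,
    UpperHalfPlane.coe_im]
  ring

/-- The hyperbolic cosine-law estimate from the proof of Lemma 2.1 of the paper:
for a hyperbolic isometry `g` (|Tr g| > 2), `Min(g)` is nonempty and for every `x`,
`cosh (dist x (g • x)) ≥ 1 + (cosh (ℓ g) − 1) · cosh² (infDist x (Min g))`. -/
theorem cosh_dist_ge_of_hyperbolic (g : SL(2, ℝ))
    (hg : |Matrix.trace (g : Matrix (Fin 2) (Fin 2) ℝ)| > 2) :
    (MinSet g).Nonempty ∧ ∀ x : ℍ,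
      Real.cosh (dist x (g • x)) ≥
        1 + (Real.cosh (ell g) - 1) * (Real.cosh (Metric.infDist x (MinSet g))) ^ 2 := by
  have hdet : g 0 0 * g 1 1 - g 0 1 * g 1 0 = 1 := by
    rw [← Matrix.det_fin_two]; exact g.det_coe
  have hD : 0 < (g 1 1 - g 0 0) ^ 2 - 4 * g 1 0 * -g 0 1 := by
    rw [Matrix.trace_fin_two] at hg
    have h4 : 2 ^ 2 < (g 0 0 + g 1 1) ^ 2 := sq_lt_sq.2 (by rwa [abs_two])
    linarith
  have hfoot := exists_mem_geodesic_cosh_dist_sq_eq _ _ _ hD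
  have hform := cosh_dist_smul g
  have hmin : ∀ w : ℍ, g 1 0 * (w.re ^ 2 + w.im ^ 2) + (g 1 1 - g 0 0) * w.re + -g 0 1 = 0 →
      dist w (g • w) = ell g := by
    intro w hw
    refine le_antisymm (le_ciInf fun v => ?_) (ciInf_le ⟨0, ?_⟩ w)
    · rw [← abs_of_nonneg (dist_nonneg (x := w)), ← abs_of_nonneg (dist_nonneg (x := v)),
        ← Real.cosh_le_cosh, hform w, hform v, hw]
      have : 0 < v.im := v.im_pos
      simp only [ne_eq, OfNat.ofNat_ne_zero, not_false_eq_true, zero_pow, zero_div, add_zero,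
        le_add_iff_nonneg_right]
      positivity
    · rintro _ ⟨v, rfl⟩
      exact dist_nonneg
  refine ⟨?_, fun x => ?_⟩
  · obtain ⟨w, hw, -⟩ := hfoot UpperHalfPlane.I
    exact ⟨w, hmin w hw⟩
  · obtain ⟨w, hw, hxw⟩ := hfoot x
    have hinf : Real.cosh (Metric.infDist x (MinSet g)) ≤ Real.cosh (dist x w) := by
      rw [Real.cosh_le_cosh, abs_of_nonneg Metric.infDist_nonneg, abs_of_nonneg dist_nonneg]
      exact Metric.infDist_le_dist_of_mem (hmin w hw)
    have hell : Real.cosh (ell g) - 1 = ((g 1 1 - g 0 0) ^ 2 - 4 * g 1 0 * -g 0 1) / 2 := by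
      rw [← hmin w hw, hform w, hw]
      ring
    have hy : 0 < x.im := x.im_pos
    calc 1 + (Real.cosh (ell g) - 1) * Real.cosh (Metric.infDist x (MinSet g)) ^ 2
        ≤ 1 + (Real.cosh (ell g) - 1) * Real.cosh (dist x w) ^ 2 := by
          rw [hell]
          gcongr
      _ = Real.cosh (dist x (g • x)) := by
          rw [hell, hxw, hform x]
          generalize (g 1 1 - g 0 0) ^ 2 - 4 * g 1 0 * -g 0 1 = D at hD
          field_simp
          ring
end

section
/- For any three points x₁, x₂, x₃ ∈ ℍ there exists a unique point x₀ ∈ ℍ minimizing the function x ↦ dist x x₁ + dist x x₂ + dist x x₃ (i.e. there is exactly one x₀ with dist x₀ x₁ + dist x₀ x₂ + dist x₀ x₃ ≤ dist x x₁ + dist x x₂ + dist x x₃ for all x ∈ ℍ). Moreover, the resulting map ℍ × ℍ × ℍ → ℍ sending (x₁, x₂, x₃) to this minimizer x₀ is continuous. (Lemma 'Toricelli' of the paper, in the case of the hyperbolic plane.) -/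
open scoped UpperHalfPlane

namespace UpperHalfPlane

/-- The midpoint of `y` and `z`, characterised by its distance to every other point. -/
theorem exists_cosh_dist_midpoint (y z : ℍ) : ∃ m : ℍ, ∀ x : ℍ,
    2 * Real.cosh (dist y z / 2) * Real.cosh (dist m x) =
      Real.cosh (dist y x) + Real.cosh (dist z x) := by
  have hu := y.im_pos
  have hv := z.im_pos
  set N := 2 * Real.cosh (dist y z / 2) with hN
  have hNpos : 0 < N := by positivity
  have hNsq : N ^ 2 * (y.im * z.im) = (y.re - z.re) ^ 2 + (y.im + z.im) ^ 2 := by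
    have h1 : N ^ 2 = 2 + 2 * Real.cosh (dist y z) := by
      have h2 := Real.cosh_sq (dist y z / 2)
      have h3 := Real.cosh_two_mul (dist y z / 2)
      rw [mul_div_cancel₀ _ (two_ne_zero' ℝ)] at h3
      rw [hN, h3]
      linarith
    rw [h1, cosh_dist']
    field_simp
    ring
  refine ⟨mk ⟨(y.re * z.im + z.re * y.im) / (y.im + z.im), N * (y.im * z.im) / (y.im + z.im)⟩
    (by simp only; positivity), fun x ↦ ?_⟩
  have hx := x.im_pos
  simp only [cosh_dist', mk_re, mk_im]
  generalize y.re = a at *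
  generalize y.im = u at *
  generalize z.re = b at *
  generalize z.im = v at *
  generalize x.re = c at *
  generalize x.im = h at *
  have hs : u + v ≠ 0 := by positivity
  field_simp
  linear_combination (u * v) * hNsq

/-- Convexity of the distance to a point, with the equality case. -/
theorem exists_dist_midpoint_le (y z : ℍ) : ∃ m : ℍ, ∀ x : ℍ,
    dist m x ≤ (dist y x + dist z x) / 2 ∧
      ((dist y x + dist z x) / 2 ≤ dist m x → |dist y x - dist z x| = dist y z) := by
  obtain ⟨m, hm⟩ := exists_cosh_dist_midpoint y z
  refine ⟨m, fun x ↦ ?_⟩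
  have hle : |dist y x - dist z x| ≤ dist y z := abs_dist_sub_le y z x
  have hsum : Real.cosh (dist y z / 2) * Real.cosh (dist m x) =
      Real.cosh ((dist y x - dist z x) / 2) * Real.cosh ((dist y x + dist z x) / 2) := by
    have h1 := Real.cosh_add ((dist y x + dist z x) / 2) ((dist y x - dist z x) / 2)
    have h2 := Real.cosh_sub ((dist y x + dist z x) / 2) ((dist y x - dist z x) / 2)
    ring_nf at h1 h2
    have h3 := hm x
    ring_nf at h3 ⊢
    linarith
  have hpos : 0 < Real.cosh (dist y z / 2) := Real.cosh_pos _
  have hnn : 0 ≤ (dist y x + dist z x) / 2 := by positivity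
  have habs : |(dist y x - dist z x) / 2| ≤ |dist y z / 2| := by
    rw [abs_div, abs_div, abs_of_nonneg (dist_nonneg (x := y) (y := z))]
    gcongr
  constructor
  · rw [← abs_of_nonneg (dist_nonneg (x := m) (y := x)), ← abs_of_nonneg hnn,
      ← Real.cosh_le_cosh]
    refine le_of_mul_le_mul_left ?_ hpos
    rw [hsum]
    gcongr
    exact Real.cosh_le_cosh.2 habs
  · intro hge
    rw [← abs_of_nonneg (dist_nonneg (x := m) (y := x)), ← abs_of_nonneg hnn,
      ← Real.cosh_le_cosh] at hge
    have hcosh : Real.cosh (dist y z / 2) ≤ Real.cosh ((dist y x - dist z x) / 2) := by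
      refine le_of_mul_le_mul_right ?_ (Real.cosh_pos (dist m x))
      rw [hsum]
      gcongr
    rw [Real.cosh_le_cosh, abs_div, abs_div,
      abs_of_nonneg (dist_nonneg (x := y) (y := z)), abs_two] at hcosh
    linarith

/-- The sum of the distances from `x` to the three components of `p`. -/
noncomputable def fermatSum (p : ℍ × ℍ × ℍ) (x : ℍ) : ℝ :=
  dist x p.1 + dist x p.2.1 + dist x p.2.2

theorem eq_of_forall_fermatSum_le {p : ℍ × ℍ × ℍ} {y z : ℍ}
    (hy : ∀ x, fermatSum p y ≤ fermatSum p x) (hz : ∀ x, fermatSum p z ≤ fermatSum p x) :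
    y = z := by
  obtain ⟨m, hm⟩ := exists_dist_midpoint_le y z
  obtain ⟨h1, e1⟩ := hm p.1
  obtain ⟨h2, e2⟩ := hm p.2.1
  obtain ⟨h3, e3⟩ := hm p.2.2
  have hyz := hy z
  have hzy := hz y
  have hym := hy m
  unfold fermatSum at hyz hzy hym
  have e1 := e1 (by linarith)
  have e2 := e2 (by linarith)
  have e3 := e3 (by linarith)
  have hd : 0 ≤ dist y z := dist_nonneg
  -- A sum of three terms `± dist y z` vanishes, so `dist y z = 0`.
  refine dist_le_zero.1 ?_
  rcases (abs_eq hd).1 e1 with e1 | e1 <;> rcases (abs_eq hd).1 e2 with e2 | e2 <;>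
    rcases (abs_eq hd).1 e3 with e3 | e3 <;> linarith

theorem continuous_fermatSum : Continuous fun q : (ℍ × ℍ × ℍ) × ℍ ↦ fermatSum q.1 q.2 := by
  unfold fermatSum
  fun_prop

theorem exists_forall_fermatSum_le (p : ℍ × ℍ × ℍ) :
    ∃ y, ∀ x, fermatSum p y ≤ fermatSum p x := by
  have : Nonempty ℍ := ⟨p.1⟩
  refine (continuous_fermatSum.comp (Continuous.prodMk_right p)).exists_forall_le ?_
  refine Filter.tendsto_atTop_mono (fun x ↦ ?_) (tendsto_dist_right_cocompact_atTop p.1)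
  simp only [fermatSum, Function.comp_apply]
  have := dist_nonneg (x := x) (y := p.2.1)
  have := dist_nonneg (x := x) (y := p.2.2)
  linarith

open Filter Topology in
theorem continuous_of_forall_fermatSum_le {f : ℍ × ℍ × ℍ → ℍ}
    (hf : ∀ p x, fermatSum p (f p) ≤ fermatSum p x) : Continuous f := by
  refine continuous_iff_continuousAt.2 fun p₀ ↦ ?_
  let c : ℍ × ℍ × ℍ → ℝ := fun p ↦ fermatSum p p.1 + dist p.1 p₀.1
  have hc : Continuous c :=
    (continuous_fermatSum.comp (continuous_id.prodMk continuous_fst)).add (by fun_prop)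
  have hbound : ∀ᶠ p in 𝓝 p₀, f p ∈ Metric.closedBall p₀.1 (c p₀ + 1) := by
    filter_upwards [hc.continuousAt.eventually_lt_const (lt_add_one (c p₀))] with p hp
    have h1 := hf p p.1
    have h2 := dist_triangle (f p) p.1 p₀.1
    have h3 : dist (f p) p.1 ≤ fermatSum p (f p) := by
      have := dist_nonneg (x := f p) (y := p.2.1)
      have := dist_nonneg (x := f p) (y := p.2.2)
      unfold fermatSum
      linarith
    rw [Metric.mem_closedBall]
    simp only [c] at hp ⊢
    linarith
  refine (isCompact_closedBall _ _).tendsto_nhds_of_unique_mapClusterPt hbound fun y _ hy ↦ ?_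
  obtain ⟨U, hU, hUy⟩ := mapClusterPt_iff_ultrafilter.1 hy
  refine eq_of_forall_fermatSum_le (p := p₀) (fun x ↦ ?_) (hf p₀)
  have hid : Tendsto id (U : Filter (ℍ × ℍ × ℍ)) (𝓝 p₀) := hU
  exact le_of_tendsto_of_tendsto'
    ((continuous_fermatSum.tendsto (p₀, y)).comp (hid.prodMk_nhds hUy))
    ((continuous_fermatSum.tendsto (p₀, x)).comp (hid.prodMk_nhds tendsto_const_nhds))
    fun p ↦ hf p x

end UpperHalfPlane

/-- Lemma `Toricelli` of the paper, for the hyperbolic plane: any three points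
`x₁, x₂, x₃ ∈ ℍ` admit a unique Fermat point (minimizer of the sum of the distances to the
three points), and the resulting map `ℍ × ℍ × ℍ → ℍ` is continuous. -/
theorem fermat_point_exists_unique_continuous :
    ∃ f : ℍ × ℍ × ℍ → ℍ, Continuous f ∧
      ∀ x₁ x₂ x₃ : ℍ,
        (∀ x : ℍ,
          dist (f (x₁, x₂, x₃)) x₁ + dist (f (x₁, x₂, x₃)) x₂ + dist (f (x₁, x₂, x₃)) x₃ ≤
            dist x x₁ + dist x x₂ + dist x x₃) ∧
        (∀ y : ℍ,
          (∀ x : ℍ, dist y x₁ + dist y x₂ + dist y x₃ ≤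
            dist x x₁ + dist x x₂ + dist x x₃) → y = f (x₁, x₂, x₃)) := by
  choose f hf using UpperHalfPlane.exists_forall_fermatSum_le
  exact ⟨f, UpperHalfPlane.continuous_of_forall_fermatSum_le hf, fun x₁ x₂ x₃ ↦
    ⟨hf (x₁, x₂, x₃), fun y hy ↦
      UpperHalfPlane.eq_of_forall_fermatSum_le (p := (x₁, x₂, x₃)) hy (hf (x₁, x₂, x₃))⟩⟩
end

section
/- Let x₁, x₂, x₃ ∈ ℍ and suppose that for every triple (i, j, k) with {i, j, k} = {1, 2, 3} one has dist xᵢ xⱼ + dist xⱼ xₖ − dist xᵢ xₖ > Real.log 3. Then the Fermat point x₀ of (x₁, x₂, x₃) satisfies x₀ ≠ x₁, x₀ ≠ x₂ and x₀ ≠ x₃. (Lemma 'FermatDedans' of the paper, in the hyperbolic-plane case, with the explicit constant 2A = log 3, A = (1/2) log 3.) -/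
open scoped UpperHalfPlane

namespace UpperHalfPlane

/-- A combination of two points which is normalized in the hyperboloid model is again a point
of the hyperbolic plane. -/
theorem exists_cosh_dist_eq_combination (p q : ℍ) {α β : ℝ} (hα : 0 < α) (hβ : 0 < β)
    (h : α ^ 2 + β ^ 2 + 2 * α * β * Real.cosh (dist p q) = 1) :
    ∃ y : ℍ, ∀ r : ℍ,
      Real.cosh (dist y r) = α * Real.cosh (dist p r) + β * Real.cosh (dist q r) := by
  have hp := p.im_pos
  have hq := q.im_pos
  have hX : 0 < α / p.im + β / q.im := by positivity
  refine ⟨⟨⟨(α * p.re / p.im + β * q.re / q.im) / (α / p.im + β / q.im),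
    1 / (α / p.im + β / q.im)⟩, by simpa using hX⟩, fun r => ?_⟩
  have hr := r.im_pos
  rw [cosh_dist'] at h
  rw [cosh_dist', cosh_dist', cosh_dist']
  simp only [mk_re, mk_im]
  have hD : 0 < α * q.im + p.im * β := by positivity
  field_simp at h ⊢
  linear_combination (-p.im * q.im) * h

/-- Points at a prescribed distance along a geodesic segment, with Stewart's formula. -/
theorem exists_dist_eq_and_stewart (p q : ℍ) {t : ℝ} (ht : 0 < t) (hta : t < dist p q) :
    ∃ y : ℍ, dist y p = t ∧ dist y q = dist p q - t ∧ ∀ r : ℍ,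
      Real.cosh (dist y r) * Real.sinh (dist p q) =
        Real.sinh (dist p q - t) * Real.cosh (dist p r) +
          Real.sinh t * Real.cosh (dist q r) := by
  set a := dist p q with ha
  have hs : 0 < Real.sinh a := Real.sinh_pos_iff.2 (ht.trans hta)
  have hst : 0 < Real.sinh t := Real.sinh_pos_iff.2 ht
  have hsat : 0 < Real.sinh (a - t) := Real.sinh_pos_iff.2 (sub_pos.2 hta)
  obtain ⟨y, hy⟩ := exists_cosh_dist_eq_combination p q (div_pos hsat hs) (div_pos hst hs) (by
    rw [← ha, Real.sinh_sub]
    field_simp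
    linear_combination (-Real.sinh t ^ 2) * Real.cosh_sq a + Real.sinh a ^ 2 * Real.cosh_sq t)
  have hy' (r : ℍ) : Real.cosh (dist y r) * Real.sinh a =
      Real.sinh (a - t) * Real.cosh (dist p r) + Real.sinh t * Real.cosh (dist q r) := by
    rw [hy]
    field_simp
  refine ⟨y, ?_, ?_, hy'⟩
  · apply Real.cosh_injOn dist_nonneg ht.le
    apply mul_right_cancel₀ hs.ne'
    rw [hy', dist_self, dist_comm q p, ← ha, Real.cosh_zero, Real.sinh_sub]
    ring
  · apply Real.cosh_injOn dist_nonneg (sub_pos.2 hta).le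
    apply mul_right_cancel₀ hs.ne'
    rw [hy', dist_self, ← ha, Real.cosh_zero, Real.sinh_sub, Real.cosh_sub]
    linear_combination (-Real.sinh t) * Real.cosh_sq a

/-- If the angle at `p` is acute, some point near `p` on the segment from `p` to `q` has a
smaller sum of distances to `p`, `q` and `r` than `p` has. -/
theorem exists_sum_dist_lt_of_acute {p q r : ℍ} (hpq : 0 < dist p q)
    (h : Real.cosh (dist q r) < Real.cosh (dist p q) * Real.cosh (dist p r)) :
    ∃ y : ℍ, dist y p + dist y q + dist y r < dist p q + dist p r := by
  set a := dist p q with ha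
  set K := Real.sinh a * Real.cosh (dist p r)
  set D := Real.cosh a * Real.cosh (dist p r) - Real.cosh (dist q r)
  have hev : ∀ᶠ s in nhdsWithin (0 : ℝ) (Set.Ioi 0),
      Real.sinh s * K < Real.cosh s * D := by
    apply Filter.Eventually.filter_mono nhdsWithin_le_nhds
    apply ContinuousAt.eventually_lt (by fun_prop) (by fun_prop)
    simpa [D] using h
  obtain ⟨s, hs, hs0, hsa⟩ :=
    (hev.and (Ioo_mem_nhdsGT (half_pos hpq))).exists
  obtain ⟨y, hyp, hyq, hy⟩ := exists_dist_eq_and_stewart p q (t := 2 * s)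
    (by linarith) (by linarith)
  refine ⟨y, ?_⟩
  suffices dist y r < dist p r by linarith
  have hlt : Real.cosh (dist y r) < Real.cosh (dist p r) := by
    refine lt_of_mul_lt_mul_right ?_ (Real.sinh_pos_iff.2 hpq).le
    rw [hy r, ← ha, Real.sinh_sub, Real.sinh_two_mul, Real.cosh_two_mul, Real.cosh_sq s]
    have hm := mul_lt_mul_of_pos_left hs (Real.sinh_pos_iff.2 hs0)
    simp only [K, D] at hm
    linarith
  simpa [Real.cosh_lt_cosh, abs_of_nonneg] using hlt

end UpperHalfPlane

theorem Real.cosh_lt_cosh_mul_cosh_of_log_three_lt {a b c : ℝ} (hc : 0 ≤ c)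
    (h : Real.log 3 < a + b - c) : Real.cosh c < Real.cosh a * Real.cosh b := by
  have hS : Real.cosh c < Real.cosh (a + b - Real.log 3) := by
    rw [Real.cosh_lt_cosh, abs_of_nonneg hc, abs_of_nonneg (by linarith)]
    linarith
  have h3 : 3 ≤ Real.exp (a + b) :=
    (Real.log_le_iff_le_exp (by norm_num)).1 (by linarith)
  have hinv : Real.exp (-(a + b)) ≤ 1 / 3 := by
    rw [Real.exp_neg, inv_eq_one_div]
    exact one_div_le_one_div_of_le (by norm_num) h3
  have hexp : Real.cosh (a + b - Real.log 3) =
      (Real.exp (a + b) / 3 + 3 * Real.exp (-(a + b))) / 2 := by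
    rw [Real.cosh_eq, Real.exp_sub, neg_sub, sub_eq_add_neg, Real.exp_add (Real.log 3),
      Real.exp_log (by norm_num)]
  have hsum := Real.cosh_add a b
  have hsub := Real.cosh_sub a b
  have hone := Real.one_le_cosh (a - b)
  have hcosh := Real.cosh_eq (a + b)
  linarith

/-- A vertex whose strict triangle inequality has defect more than `log 3` does not minimize
the sum of distances. -/
theorem UpperHalfPlane.exists_sum_dist_lt_of_log_three_lt {p q r : ℍ}
    (h : Real.log 3 < dist q p + dist p r - dist q r) :
    ∃ y : ℍ, dist y p + dist y q + dist y r < dist p q + dist p r := by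
  rw [dist_comm q p] at h
  refine exists_sum_dist_lt_of_acute ?_ (Real.cosh_lt_cosh_mul_cosh_of_log_three_lt dist_nonneg h)
  have := dist_triangle p q r
  have := Real.log_pos (show (1 : ℝ) < 3 by norm_num)
  linarith

/-- Lemma `FermatDedans` of the paper, in the hyperbolic-plane case with the explicit
constant `2A = log 3`: if each triangle inequality among `x 0, x 1, x 2` is strict by more
than `log 3`, then the Fermat point (the minimizer of the sum of distances to the three
points) is distinct from each of the three points. -/
theorem fermat_point_ne_vertices (x : Fin 3 → ℍ)
    (hV : ∀ i j k : Fin 3, i ≠ j → j ≠ k → i ≠ k →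
      dist (x i) (x j) + dist (x j) (x k) - dist (x i) (x k) > Real.log 3)
    (x₀ : ℍ)
    (hmin : ∀ y : ℍ,
      dist x₀ (x 0) + dist x₀ (x 1) + dist x₀ (x 2) ≤
        dist y (x 0) + dist y (x 1) + dist y (x 2)) :
    ∀ i : Fin 3, x₀ ≠ x i := by
  intro i hi
  subst hi
  fin_cases i
  · obtain ⟨y, hy⟩ := UpperHalfPlane.exists_sum_dist_lt_of_log_three_lt
      (hV 1 0 2 (by decide) (by decide) (by decide))
    have := hmin y
    simp only [Fin.zero_eta, dist_self] at this
    linarith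
  · obtain ⟨y, hy⟩ := UpperHalfPlane.exists_sum_dist_lt_of_log_three_lt
      (hV 0 1 2 (by decide) (by decide) (by decide))
    have := hmin y
    simp only [Fin.mk_one, dist_self] at this
    linarith
  · obtain ⟨y, hy⟩ := UpperHalfPlane.exists_sum_dist_lt_of_log_three_lt
      (hV 0 2 1 (by decide) (by decide) (by decide))
    have := hmin y
    simp only [Fin.reduceFinMk, dist_self] at this
    linarith
end

section
/- Let ι be a nonempty finite type. Then the function F : (ι → SL(2,ℝ)) → ℝ defined by F(g) = ⨅_{x ∈ ℍ} (max over i ∈ ι of dist x ((g i) • x)) is continuous, where ι → SL(2,ℝ) carries the product topology and SL(2,ℝ) the topology induced from 2×2 real matrices. (Proposition 2.9 of the paper, 'dcontinu', in the case n = 2: continuity of the minimal joint displacement of a tuple of isometries.) -/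
open scoped MatrixGroups UpperHalfPlane

/-- The topology on `SL(2, ℝ)` induced from the space of 2×2 real matrices
(the subtype topology). -/
noncomputable instance : TopologicalSpace SL(2, ℝ) := instTopologicalSpaceSubtype

namespace UpperHalfPlane

/-- The point `t * I` of the imaginary axis, for `t > 0`. -/
def imAxis (t : ℝ) (ht : 0 < t) : ℍ := ⟨⟨0, t⟩, ht⟩

/-- The hyperbolic cosine of the displacement of `t * I`, in terms of matrix entries. -/
lemma cosh_dist_imAxis_smul (g : SL(2, ℝ)) {t : ℝ} (ht : 0 < t) :
    Real.cosh (dist (imAxis t ht) (g • imAxis t ht)) =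
      ((g 0 0) ^ 2 + (g 1 1) ^ 2 + (g 1 0) ^ 2 * t ^ 2 + (g 0 1) ^ 2 / t ^ 2) / 2 := by
  have hdet : g 0 0 * g 1 1 - g 0 1 * g 1 0 = 1 := by
    rw [← Matrix.det_fin_two]; exact g.det_coe
  have hne : g 1 0 ^ 2 * t ^ 2 + g 1 1 ^ 2 ≠ 0 := by
    intro h
    have h1 : g 1 1 = 0 := by nlinarith [sq_nonneg (g 1 0 * t), sq_nonneg (g 1 1)]
    have h2 : g 1 0 * t = 0 := by nlinarith [sq_nonneg (g 1 0 * t), sq_nonneg (g 1 1)]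
    have h3 : g 1 0 = 0 := by simpa [ht.ne'] using h2
    rw [h1, h3] at hdet
    norm_num at hdet
  have hcoe : ((g • imAxis t ht : ℍ) : ℂ) =
      ⟨(g 0 0 * g 1 0 * t ^ 2 + g 0 1 * g 1 1) / (g 1 0 ^ 2 * t ^ 2 + g 1 1 ^ 2),
        t / (g 1 0 ^ 2 * t ^ 2 + g 1 1 ^ 2)⟩ := by
    rw [coe_specialLinearGroup_apply, div_eq_iff (mod_cast denom_ne_zero g (imAxis t ht))]
    apply Complex.ext
    · simp [imAxis]
      field_simp
      linear_combination -g 1 0 * t ^ 2 * hdet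
    · simp [imAxis]
      field_simp
      rw [eq_div_iff (by rwa [mul_comm (t ^ 2)])]
      linear_combination g 1 1 * hdet
  rw [cosh_dist, Complex.dist_eq, ← Complex.normSq_eq_norm_sq, Complex.normSq_apply,
    Complex.sub_re, Complex.sub_im]
  change 1 + _ / (2 * t * ((g • imAxis t ht : ℍ) : ℂ).im) = _
  rw [hcoe]
  simp only [imAxis]
  field_simp
  linear_combination -t ^ 2 * (g 0 0 * g 1 1 - g 0 1 * g 1 0 + 1) * hdet

/-- Every point of `ℍ` can be rotated about `I` onto the imaginary axis. -/
lemma exists_smul_imAxis (z : ℍ) :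
    ∃ (k : SL(2, ℝ)) (t : ℝ) (ht : 0 < t), k • I = I ∧ k • imAxis t ht = z := by
  set w : ℂ := ⟨(1 - z.re ^ 2 - z.im ^ 2) / 2, -z.re⟩
  have hc : ‖w‖ * Real.cos w.arg = (1 - z.re ^ 2 - z.im ^ 2) / 2 := Complex.norm_mul_cos_arg w
  have hs : ‖w‖ * Real.sin w.arg = -z.re := Complex.norm_mul_sin_arg w
  have h2 : w.arg = 2 * (w.arg / 2) := by ring
  rw [h2, Real.cos_two_mul'] at hc
  rw [h2, Real.sin_two_mul] at hs
  set θ := w.arg / 2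
  have h1 := Real.sin_sq_add_cos_sq θ
  let k : SL(2, ℝ) := ⟨!![Real.cos θ, Real.sin θ; -Real.sin θ, Real.cos θ], by
    rw [Matrix.det_fin_two_of]; linear_combination h1⟩
  have hI : k • I = I := by
    ext
    rw [coe_specialLinearGroup_apply, div_eq_iff (mod_cast denom_ne_zero k I)]
    apply Complex.ext <;> simp [k]
  have hre : ((k • z : ℍ) : ℂ).re = 0 := by
    rw [coe_specialLinearGroup_apply, Complex.div_re, ← add_div]
    convert zero_div _
    simp [k]
    simp only [Complex.cos_ofReal_re, Complex.sin_ofReal_re]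
    linear_combination (Real.cos θ ^ 2 - Real.sin θ ^ 2) * hs -
      2 * Real.sin θ * Real.cos θ * hc
  refine ⟨k⁻¹, (k • z).im, (k • z).im_pos, by rw [inv_smul_eq_iff, hI], ?_⟩
  rw [inv_smul_eq_iff]
  ext
  exact Complex.ext hre.symm rfl

/-- The distance from `I` to `t * I` is `|log t|`. -/
lemma dist_I_imAxis {t : ℝ} (ht : 0 < t) : dist I (imAxis t ht) = |Real.log t| := by
  rw [dist_of_re_eq (by simp [imAxis]), Real.dist_eq, I_im]
  simp [imAxis]

/-- Every point can be pulled back into the ball of radius `R` about `I` while increasing the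
displacement of each isometry by an amount controlled by `exp (-2 * R)`. -/
lemma exists_mem_closedBall_cosh_dist_smul_le (x : ℍ) {R : ℝ} (hR : 0 ≤ R) :
    ∃ y ∈ Metric.closedBall I R, ∀ g : SL(2, ℝ), Real.cosh (dist y (g • y)) ≤
      Real.cosh (dist x (g • x)) + Real.exp (-2 * R) * Real.cosh (dist I (g • I)) := by
  obtain ⟨k, t, ht, hI, rfl⟩ := exists_smul_imAxis x
  have hdisp (g : SL(2, ℝ)) (y : ℍ) :
      dist (k • y) (g • k • y) = dist y ((k⁻¹ * g * k) • y) := by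
    rw [← dist_smul k y, smul_smul, smul_smul]
    congr 2
    group
  have hI1 : imAxis 1 one_pos = I := by ext; apply Complex.ext <;> simp [imAxis]
  have hdispI (g : SL(2, ℝ)) : Real.cosh (dist I (g • I)) =
      Real.cosh (dist (imAxis 1 one_pos) ((k⁻¹ * g * k) • imAxis 1 one_pos)) := by
    have := hdisp g I
    rw [hI] at this
    rw [this, hI1]
  obtain ⟨s, hs, hsR, hle⟩ : ∃ s : ℝ, 0 < s ∧ |Real.log s| ≤ R ∧ ∀ q r : ℝ,
      r ^ 2 * s ^ 2 + q ^ 2 / s ^ 2 ≤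
        r ^ 2 * t ^ 2 + q ^ 2 / t ^ 2 + Real.exp (-2 * R) * (q ^ 2 + r ^ 2) := by
    have hE : Real.exp (-2 * R) = 1 / Real.exp R ^ 2 := by
      rw [← Real.exp_nat_mul, one_div, ← Real.exp_neg]; simp
    have hE' : Real.exp (-2 * R) = Real.exp (-R) ^ 2 := by
      rw [← Real.exp_nat_mul]; simp
    rcases le_total (Real.exp R) t with h | h
    · refine ⟨Real.exp R, Real.exp_pos R, by rw [Real.log_exp, abs_of_nonneg hR], fun q r ↦ ?_⟩
      have h1 : r ^ 2 * Real.exp R ^ 2 ≤ r ^ 2 * t ^ 2 := by gcongr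
      have h2 : 0 ≤ q ^ 2 / t ^ 2 := by positivity
      have h3 : 0 ≤ Real.exp (-2 * R) * r ^ 2 := by positivity
      have h4 : q ^ 2 / Real.exp R ^ 2 = Real.exp (-2 * R) * q ^ 2 := by rw [hE]; ring
      linarith
    rcases le_total t (Real.exp (-R)) with h' | h'
    · refine ⟨Real.exp (-R), Real.exp_pos _, by rw [Real.log_exp, abs_neg, abs_of_nonneg hR],
        fun q r ↦ ?_⟩
      have h1 : q ^ 2 / Real.exp (-R) ^ 2 ≤ q ^ 2 / t ^ 2 := by gcongr
      have h2 : 0 ≤ r ^ 2 * t ^ 2 := by positivity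
      have h3 : 0 ≤ Real.exp (-2 * R) * q ^ 2 := by positivity
      rw [← hE'] at h1 ⊢
      linarith
    · refine ⟨t, ht, abs_le.2 ⟨(Real.le_log_iff_exp_le ht).2 h', (Real.log_le_iff_le_exp ht).2 h⟩,
        fun q r ↦ le_add_of_nonneg_right (by positivity)⟩
  refine ⟨k • imAxis s hs, ?_, fun g ↦ ?_⟩
  · rw [Metric.mem_closedBall, dist_comm]
    conv_lhs => rw [← hI]
    rwa [dist_smul, dist_I_imAxis]
  · rw [hdisp, hdisp, hdispI, cosh_dist_imAxis_smul, cosh_dist_imAxis_smul, cosh_dist_imAxis_smul]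
    set h := k⁻¹ * g * k
    have := hle (h 0 1) (h 1 0)
    have h3 : 0 ≤ Real.exp (-2 * R) * (h 0 0 ^ 2 + h 1 1 ^ 2) := by positivity
    linarith

end UpperHalfPlane

/-- If `cosh b` exceeds `cosh a` by at most `cosh ε - 1`, then `b ≤ a + ε`. -/
lemma Real.le_add_of_cosh_le {a b ε : ℝ} (ha : 0 ≤ a) (hε : 0 ≤ ε)
    (h : Real.cosh b ≤ Real.cosh a + (Real.cosh ε - 1)) : b ≤ a + ε := by
  have h1 : Real.cosh b ≤ Real.cosh (a + ε) := by
    rw [Real.cosh_add]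
    have := mul_nonneg (Real.sinh_nonneg_iff.2 ha) (Real.sinh_nonneg_iff.2 hε)
    nlinarith [Real.one_le_cosh a, Real.one_le_cosh ε]
  rw [Real.cosh_le_cosh, abs_of_nonneg (add_nonneg ha hε)] at h1
  exact (le_abs_self b).trans h1

open UpperHalfPlane in
/-- The joint displacement is continuous in the tuple of isometries and the point. -/
lemma continuous_jointDisplacement (ι : Type*) [Fintype ι] [Nonempty ι] :
    Continuous fun p : (ι → SL(2, ℝ)) × ℍ => ⨆ i : ι, dist p.2 (p.1 i • p.2) := by
  have : ContinuousSMul SL(2, ℝ) ℍ := instContinuousSMulSL2R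
  simp_rw [← Finset.sup'_univ_eq_ciSup]
  refine Continuous.finset_sup'_apply _ fun i _ ↦ ?_
  exact continuous_snd.dist (((continuous_apply i).comp continuous_fst).smul continuous_snd)

/-- Proposition 2.9 of the paper (`dcontinu`, case n = 2): for a nonempty finite index
type `ι`, the minimal joint displacement
`g ↦ ⨅_{x ∈ ℍ} max_{i ∈ ι} dist x ((g i) • x)` is a continuous function of the tuple
`g : ι → SL(2, ℝ)`. -/
theorem minimal_joint_displacement_continuous (ι : Type*) [Fintype ι] [Nonempty ι] :
    Continuous fun g : ι → SL(2, ℝ) =>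
      ⨅ x : ℍ, ⨆ i : ι, dist x ((g i) • x) := by
  set M : (ι → SL(2, ℝ)) → ℍ → ℝ := fun g x ↦ ⨆ i : ι, dist x (g i • x)
  have hcont : Continuous fun p : (ι → SL(2, ℝ)) × ℍ => M p.1 p.2 :=
    continuous_jointDisplacement ι
  have hle (g : ι → SL(2, ℝ)) (x : ℍ) (i : ι) : dist x (g i • x) ≤ M g x :=
    le_ciSup (f := fun i ↦ dist x (g i • x)) (Set.finite_range _).bddAbove i
  have hnonneg (g : ι → SL(2, ℝ)) (x : ℍ) : 0 ≤ M g x := Real.iSup_nonneg fun _ ↦ dist_nonneg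
  have hsup (g : ι → SL(2, ℝ)) (x : ℍ) (B : ℝ) (h : ∀ i, dist x (g i • x) ≤ B) : M g x ≤ B :=
    ciSup_le h
  change Continuous fun g ↦ ⨅ x, M g x
  clear_value M
  refine continuous_of_locally_uniform_approx_of_continuousAt fun g₀ u hu ↦ ?_
  obtain ⟨ε, hε, hεu⟩ := Metric.mem_uniformity_dist.1 hu
  have hδ : 0 < Real.cosh (ε / 2) - 1 := by
    linarith [Real.one_lt_cosh.2 (half_pos hε).ne']
  set C := Real.cosh (M g₀ UpperHalfPlane.I + 1)
  have hCpos : 0 < C := Real.cosh_pos _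
  obtain ⟨R, hR, hRC⟩ : ∃ R : ℝ, 0 ≤ R ∧ Real.exp (-2 * R) * C ≤ Real.cosh (ε / 2) - 1 := by
    have ht : Filter.Tendsto (fun R : ℝ ↦ Real.exp (-2 * R) * C) Filter.atTop (nhds (0 * C)) :=
      (Real.tendsto_exp_atBot.comp
        (Filter.tendsto_id.const_mul_atTop_of_neg (by norm_num))).mul_const C
    rw [zero_mul] at ht
    exact ((Filter.eventually_ge_atTop 0).and (ht.eventually_le_const hδ)).exists
  refine ⟨{g | M g UpperHalfPlane.I < M g₀ UpperHalfPlane.I + 1}, ?_,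
    fun g ↦ sInf (M g '' Metric.closedBall UpperHalfPlane.I R), ?_, ?_⟩
  · have hc : Continuous fun g ↦ M g UpperHalfPlane.I :=
      hcont.comp (Continuous.prodMk_left UpperHalfPlane.I)
    exact hc.continuousAt.eventually_lt_const (lt_add_one (M g₀ UpperHalfPlane.I))
  · exact ((isCompact_closedBall UpperHalfPlane.I R).continuous_sInf hcont).continuousAt
  · intro g hg
    apply hεu
    have hne : (M g '' Metric.closedBall UpperHalfPlane.I R).Nonempty :=
      ⟨_, UpperHalfPlane.I, Metric.mem_closedBall_self hR, rfl⟩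
    have hbdd : BddBelow (Set.range (M g)) := ⟨0, by rintro _ ⟨x, rfl⟩; exact hnonneg g x⟩
    have h1 : ⨅ x, M g x ≤ sInf (M g '' Metric.closedBall UpperHalfPlane.I R) :=
      le_csInf hne (by rintro _ ⟨x, _, rfl⟩; exact ciInf_le hbdd x)
    have h2 : sInf (M g '' Metric.closedBall UpperHalfPlane.I R) - ε / 2 ≤ ⨅ x, M g x := by
      refine le_ciInf fun x ↦ ?_
      obtain ⟨y, hy, hyx⟩ := UpperHalfPlane.exists_mem_closedBall_cosh_dist_smul_le x hR
      have h3 : sInf (M g '' Metric.closedBall UpperHalfPlane.I R) ≤ M g y :=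
        csInf_le (hbdd.mono (Set.image_subset_range _ _)) ⟨y, hy, rfl⟩
      have h4 : M g y ≤ M g x + ε / 2 := by
        refine hsup g y _ fun i ↦ ?_
        have h5 : Real.cosh (dist UpperHalfPlane.I (g i • UpperHalfPlane.I)) ≤ C := by
          rw [Real.cosh_le_cosh, abs_of_nonneg dist_nonneg, abs_of_nonneg
            (by linarith [hnonneg g₀ UpperHalfPlane.I])]
          exact (hle g UpperHalfPlane.I i).trans (le_of_lt hg)
        have h6 : dist y (g i • y) ≤ dist x (g i • x) + ε / 2 := by
          refine Real.le_add_of_cosh_le dist_nonneg (half_pos hε).le ((hyx (g i)).trans ?_)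
          gcongr
          exact (mul_le_mul_of_nonneg_left h5 (Real.exp_pos _).le).trans hRC
        linarith [hle g x i]
      linarith
    rw [Real.dist_eq, abs_lt]
    constructor <;> linarith
end

section
/- Let Γ be a group and let ρ₁, ρ₂ : Γ →* SL(2,ℝ) be group homomorphisms, both non-elementary. Suppose that for every γ ∈ Γ one has |Tr (ρ₁ γ)| = |Tr (ρ₂ γ)|. Then there exists g ∈ GL(2,ℝ) such that for every γ ∈ Γ, the matrix of ρ₁ γ equals g · (ρ₂ γ) · g⁻¹ or equals −(g · (ρ₂ γ) · g⁻¹). (The non-elementary case of Proposition 2.24 of the paper: representations with equal characters are conjugate by an isometry of ℍ².) -/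
open scoped MatrixGroups

/-- A homomorphism into `SL(2, ℝ)` is non-elementary if some commutator has trace ≠ 2. -/
def NonElementary {Γ : Type*} [Group Γ]
    (ρ : Γ →* Matrix.SpecialLinearGroup (Fin 2) ℝ) : Prop :=
  ∃ γ δ : Γ,
    Matrix.trace ((ρ γ * ρ δ * (ρ γ)⁻¹ * (ρ δ)⁻¹ : SL(2, ℝ)) : Matrix (Fin 2) (Fin 2) ℝ) ≠ 2

/-- The properties of the trace function of an `SL(2, ℝ)`-valued representation that are used to
compare characters up to sign. -/
structure IsTraceFunction {Γ : Type*} [Group Γ] (t : Γ → ℝ) : Prop where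
  one : t 1 = 2
  comm (a b : Γ) : t (a * b) = t (b * a)
  mul (a b : Γ) : t a * t b = t (a * b) + t (a * b⁻¹)
  mul_ne_zero (a b : Γ) : t a = 0 → t b = 0 → t (a * b) ≠ 0

namespace IsTraceFunction

variable {Γ : Type*} [Group Γ] {t u : Γ → ℝ}

lemma inv (hu : IsTraceFunction u) (a : Γ) : u a⁻¹ = u a := by
  have h := hu.mul 1 a
  rw [hu.one, one_mul, one_mul] at h
  linarith

lemma conj (hu : IsTraceFunction u) (a b : Γ) : u (a * b * a⁻¹) = u b := by
  rw [hu.comm]; simp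

lemma mul_inv_of_left (hu : IsTraceFunction u) {a : Γ} (ha : u a = 0) (b : Γ) :
    u (a * b⁻¹) = -u (a * b) := by
  have h := hu.mul a b
  rw [ha, zero_mul] at h
  linarith

lemma inv_mul_of_left (hu : IsTraceFunction u) {a : Γ} (ha : u a = 0) (b : Γ) :
    u (a⁻¹ * b) = -u (a * b) := by
  rw [← hu.inv, mul_inv_rev, inv_inv, hu.comm, hu.mul_inv_of_left ha]

lemma ne_zero_iff {α : Type*} {t u : α → ℝ} (h : ∀ γ, |t γ| = |u γ|) (γ : α) :
    t γ ≠ 0 ↔ u γ ≠ 0 := by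
  rw [← abs_ne_zero, h, abs_ne_zero]

lemma div_eq_one_or {α : Type*} {t u : α → ℝ} (h : ∀ γ, |t γ| = |u γ|)
    {a : α} (ha : u a ≠ 0) :
    t a / u a = 1 ∨ t a / u a = -1 := by
  rcases abs_eq_abs.1 (h a) with h | h
  · left; rw [h, div_self ha]
  · right; rw [h, neg_div, div_self ha]

lemma div_mul_self {α : Type*} {t u : α → ℝ} (h : ∀ γ, |t γ| = |u γ|)
    {a : α} (ha : u a ≠ 0) :
    t a / u a * (t a / u a) = 1 := by
  rcases div_eq_one_or h ha with h | h <;> rw [h] <;> norm_num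

lemma div_mul (ht : IsTraceFunction t) (hu : IsTraceFunction u) (h : ∀ γ, |t γ| = |u γ|)
    {a b : Γ} (ha : u a ≠ 0) (hb : u b ≠ 0) (hab : u (a * b) ≠ 0) :
    t (a * b) / u (a * b) = t a / u a * (t b / u b) := by
  have h₁ := ht.mul a b
  have h₂ := hu.mul a b
  have hne := _root_.mul_ne_zero ha hb
  rw [div_mul_div_comm, div_eq_div_iff hab hne]
  rcases abs_eq_abs.1 (h a) with ea | ea <;> rcases abs_eq_abs.1 (h b) with eb | eb <;>
    rcases abs_eq_abs.1 (h (a * b)) with ec | ec <;>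
    rcases abs_eq_abs.1 (h (a * b⁻¹)) with ed | ed <;>
    rw [ea, eb, ec, ed] at h₁ <;> rw [ea, eb, ec] <;>
    first
    | ring1
    | exact absurd (by linarith) hab
    | exact absurd (by linarith) hne

/-- The sign of a product does not depend on the auxiliary element used to read it off. -/
lemma sign_unique (ht : IsTraceFunction t) (hu : IsTraceFunction u) (h : ∀ γ, |t γ| = |u γ|)
    {a s r : Γ} (hs : u s ≠ 0) (has : u (a * s) ≠ 0) (hr : u r ≠ 0) (har : u (a * r) ≠ 0) :
    t s / u s * (t (a * s) / u (a * s)) = t r / u r * (t (a * r) / u (a * r)) := by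
  have key : ∀ r : Γ, u r ≠ 0 → u (a * r) ≠ 0 → u (s * r⁻¹) ≠ 0 →
      t s / u s * (t (a * s) / u (a * s)) = t r / u r * (t (a * r) / u (a * r)) := by
    intro r hr har hsr
    have e₁ := div_mul ht hu h hs (b := r⁻¹) (by rwa [hu.inv]) hsr
    have e : a * s * (a * r)⁻¹ = a * (s * r⁻¹) * a⁻¹ := by group
    have e₂ := div_mul ht hu h has (b := (a * r)⁻¹) (by rwa [hu.inv]) (by rwa [e, hu.conj])
    rw [e, ht.conj, hu.conj, ht.inv, hu.inv] at e₂
    rw [ht.inv, hu.inv] at e₁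
    rw [e₁] at e₂
    have q₁ := div_mul_self h hs
    have q₂ := div_mul_self h har
    linear_combination (t s / u s * (t (a * r) / u (a * r))) * (-e₂)
      + (t r / u r * (t (a * r) / u (a * r))) * q₁ - (t s / u s * (t (a * s) / u (a * s))) * q₂
  by_cases ha : u a = 0
  · have ha' : t a = 0 := by simpa using (ne_zero_iff h a).not.2 (by simpa using ha)
    by_cases hsr : u (s * r⁻¹) = 0
    · have hsr' : u (s * r⁻¹⁻¹) ≠ 0 := by
        intro h0
        rw [inv_inv] at h0
        have := hu.mul s r
        rw [hsr, h0, add_zero] at this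
        exact _root_.mul_ne_zero hs hr this
      rw [key r⁻¹ (by rwa [hu.inv]) (by rwa [hu.mul_inv_of_left ha, neg_ne_zero]) hsr',
        ht.inv, hu.inv, hu.mul_inv_of_left ha, ht.mul_inv_of_left ha', neg_div_neg_eq]
    · exact key r hr har hsr
  · rw [div_mul ht hu h ha hs has, div_mul ht hu h ha hr har]
    linear_combination (t a / u a) * (div_mul_self h hs) - (t a / u a) * (div_mul_self h hr)

/-- If every `a` admits `s` with `u s` and `u (a * s)` nonzero, the sign extends to the group. -/
lemma exists_sign_of_forall_exists (ht : IsTraceFunction t) (hu : IsTraceFunction u)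
    (h : ∀ γ, |t γ| = |u γ|) (hex : ∀ a, ∃ s, u s ≠ 0 ∧ u (a * s) ≠ 0) :
    ∃ ε : Γ →* ℝ, ∀ γ, (ε γ = 1 ∨ ε γ = -1) ∧ t γ = ε γ * u γ := by
  choose s hs has using hex
  set E : Γ → ℝ := fun a => t (s a) / u (s a) * (t (a * s a) / u (a * s a)) with hE
  have hEq : ∀ a r, u r ≠ 0 → u (a * r) ≠ 0 →
      E a = t r / u r * (t (a * r) / u (a * r)) := fun a r hr har =>
    sign_unique ht hu h (hs a) (has a) hr har
  have hE1 : ∀ a, E a = 1 ∨ E a = -1 := by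
    intro a
    rcases div_eq_one_or h (hs a) with h₁ | h₁ <;> rcases div_eq_one_or h (has a) with h₂ | h₂ <;>
      simp [hE, h₁, h₂]
  have hEE : ∀ a, E a * E a = 1 := fun a => by rcases hE1 a with h | h <;> rw [h] <;> norm_num
  have one_ne : u 1 ≠ 0 := by rw [hu.one]; norm_num
  have hES : ∀ a, u a ≠ 0 → E a = t a / u a := by
    intro a ha
    rw [hEq a 1 one_ne (by rwa [mul_one]), mul_one, ht.one, hu.one]
    norm_num
  have hEinv : ∀ a, E a⁻¹ = E a := by
    intro a
    rw [hEq a⁻¹ (a * s a) (has a) (by simpa using hs a), inv_mul_cancel_left]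
    exact mul_comm _ _
  have hmul3 : ∀ a b r, u r ≠ 0 → u (b * r) ≠ 0 → u (a * b * r) ≠ 0 → E (a * b) = E a * E b := by
    intro a b r hr hbr habr
    rw [hEq (a * b) r hr habr, hEq b r hr hbr, hEq a (b * r) hbr (by rwa [← mul_assoc]),
      ← mul_assoc a b r]
    linear_combination (-(t r / u r * (t (a * b * r) / u (a * b * r)))) * (div_mul_self h hbr)
  have hmulS : ∀ a b, u (a * b) ≠ 0 → E (a * b) = E a * E b := by
    intro a b hab
    by_cases hb : u b = 0
    · by_cases hc : u (a * b * s b) = 0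
      · refine hmul3 a b (s b)⁻¹ (by rw [hu.inv]; exact hs b)
          (by rw [hu.mul_inv_of_left hb, neg_ne_zero]; exact has b) ?_
        intro h0
        have := hu.mul (a * b) (s b)
        rw [hc, h0, add_zero] at this
        exact _root_.mul_ne_zero hab (hs b) this
      · exact hmul3 a b (s b) (hs b) (has b) hc
    · exact hmul3 a b 1 one_ne (by rwa [mul_one]) (by rwa [mul_one])
  have hmul : ∀ a b, E (a * b) = E a * E b := by
    intro a b
    by_cases hab : u (a * b) = 0
    · by_cases hb : u b = 0
      · have ha : u a ≠ 0 := fun ha => hu.mul_ne_zero a b ha hb hab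
        have := hmulS (a * b) b⁻¹ (by simpa using ha)
        rw [mul_inv_cancel_right, hEinv] at this
        rw [this, mul_assoc, hEE, mul_one]
      · have := hmulS a⁻¹ (a * b) (by simpa using hb)
        rw [inv_mul_cancel_left, hEinv] at this
        rw [this, ← mul_assoc, hEE, one_mul]
    · exact hmulS a b hab
  refine ⟨⟨⟨E, ?_⟩, hmul⟩, fun γ => ⟨hE1 γ, ?_⟩⟩
  · rw [hES 1 one_ne, ht.one, hu.one]; norm_num
  · change t γ = E γ * u γ
    by_cases hγ : u γ = 0
    · have : t γ = 0 := by simpa using (ne_zero_iff h γ).not.2 (by simpa using hγ)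
      rw [hγ, this, mul_zero]
    · rw [hES γ hγ, div_mul_cancel₀ _ hγ]

/-- The remaining case, in which the elements of nonzero trace form a subgroup of index two. -/
lemma exists_sign_of_exists_forall (ht : IsTraceFunction t) (hu : IsTraceFunction u)
    (h : ∀ γ, |t γ| = |u γ|) {j : Γ} (hj : ∀ s, u s ≠ 0 → u (j * s) = 0) :
    ∃ ε : Γ →* ℝ, ∀ γ, (ε γ = 1 ∨ ε γ = -1) ∧ t γ = ε γ * u γ := by
  classical
  have one_ne : u 1 ≠ 0 := by rw [hu.one]; norm_num
  have hj0 : u j = 0 := by simpa using hj 1 one_ne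
  have hj0' : t j = 0 := by simpa using (ne_zero_iff h j).not.2 (by simpa using hj0)
  have hjmul : ∀ a, u a = 0 → u (j * a) ≠ 0 := fun a ha => hu.mul_ne_zero j a hj0 ha
  have hS : ∀ a b, u a ≠ 0 → u b ≠ 0 → u (a * b) ≠ 0 := by
    intro a b ha hb hab
    have h₁ : u (a * b⁻¹) ≠ 0 := by
      intro h0
      have := hu.mul a b
      rw [hab, h0, add_zero] at this
      exact _root_.mul_ne_zero ha hb this
    have h₂ := hj _ h₁
    have h₃ := hu.mul (j * a) b
    rw [hj a ha, mul_assoc, mul_assoc, h₂, zero_mul, add_zero] at h₃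
    exact hjmul _ hab h₃.symm
  have hN : ∀ a b, u a ≠ 0 → u b = 0 → u (a * b) = 0 := by
    intro a b ha hb
    by_contra h0
    exact hS a⁻¹ (a * b) (by rwa [hu.inv]) h0 (by simpa using hb)
  set e : Γ → ℝ := fun a => t a / u a with he
  have hemul : ∀ a b, u a ≠ 0 → u b ≠ 0 → e (a * b) = e a * e b := fun a b ha hb =>
    div_mul ht hu h ha hb (hS a b ha hb)
  set E : Γ → ℝ := fun a => if u a = 0 then e (j * a) else e a with hE
  have E0 : ∀ a, u a = 0 → E a = e (j * a) := fun a ha => if_pos ha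
  have E1 : ∀ a, u a ≠ 0 → E a = e a := fun a ha => if_neg ha
  refine ⟨⟨⟨E, ?_⟩, ?_⟩, fun γ => ⟨?_, ?_⟩⟩
  · rw [E1 1 one_ne, he]; simp [ht.one, hu.one]
  · intro a b
    change E (a * b) = E a * E b
    by_cases ha : u a = 0 <;> by_cases hb : u b = 0
    · have hconj : a * j⁻¹ = j * (j⁻¹ * a) * j⁻¹ := by group
      have e₁ : e (a * j⁻¹) = e (j * a) := by
        rw [he]
        simp only
        rw [hconj, ht.conj, hu.conj, hu.inv_mul_of_left hj0, ht.inv_mul_of_left hj0',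
          neg_div_neg_eq]
      have n₁ : u (a * j⁻¹) ≠ 0 := by
        rw [hconj, hu.conj, hu.inv_mul_of_left hj0, neg_ne_zero]
        exact hjmul a ha
      have hab : a * b = a * j⁻¹ * (j * b) := by group
      have n₂ : u (a * b) ≠ 0 := by rw [hab]; exact hS _ _ n₁ (hjmul b hb)
      rw [E0 a ha, E0 b hb, E1 _ n₂, hab, hemul _ _ n₁ (hjmul b hb), e₁]
    · have n : u (a * b) = 0 := by rw [hu.comm]; exact hN b a hb ha
      rw [E0 a ha, E1 b hb, E0 _ n, ← mul_assoc, hemul _ _ (hjmul a ha) hb]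
    · have hjab : j * (a * b) = j * a * j⁻¹ * (j * b) := by group
      have e₁ : e (j * a * j⁻¹) = e a := by rw [he]; simp only; rw [ht.conj, hu.conj]
      rw [E1 a ha, E0 b hb, E0 _ (hN a b ha hb), hjab,
        hemul _ _ (by rwa [hu.conj]) (hjmul b hb), e₁]
    · rw [E1 a ha, E1 b hb, E1 _ (hS a b ha hb), hemul a b ha hb]
  · change E γ = 1 ∨ E γ = -1
    by_cases hγ : u γ = 0
    · rw [E0 γ hγ]; exact div_eq_one_or h (hjmul γ hγ)
    · rw [E1 γ hγ]; exact div_eq_one_or h hγ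
  · change t γ = E γ * u γ
    by_cases hγ : u γ = 0
    · have : t γ = 0 := by simpa using (ne_zero_iff h γ).not.2 (by simpa using hγ)
      rw [hγ, this, mul_zero]
    · rw [E1 γ hγ, he]; exact (div_mul_cancel₀ _ hγ).symm

/-- Trace functions agreeing in absolute value differ by a sign character. -/
theorem exists_sign (ht : IsTraceFunction t) (hu : IsTraceFunction u)
    (h : ∀ γ, |t γ| = |u γ|) :
    ∃ ε : Γ →* ℝ, ∀ γ, (ε γ = 1 ∨ ε γ = -1) ∧ t γ = ε γ * u γ := by
  by_cases hex : ∀ a, ∃ s, u s ≠ 0 ∧ u (a * s) ≠ 0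
  · exact exists_sign_of_forall_exists ht hu h hex
  · push Not at hex
    obtain ⟨j, hj⟩ := hex
    exact exists_sign_of_exists_forall ht hu h hj

end IsTraceFunction

lemma isTraceFunction_trace {Γ : Type*} [Group Γ] (ρ : Γ →* SL(2, ℝ)) :
    IsTraceFunction fun γ => Matrix.trace (ρ γ : Matrix (Fin 2) (Fin 2) ℝ) where
  one := by simp
  comm a b := by simpa using Matrix.trace_mul_comm _ _
  mul a b := by
    simp [Matrix.SpecialLinearGroup.coe_inv, Matrix.adjugate_fin_two, Matrix.trace_fin_two,
      Matrix.mul_apply, Fin.sum_univ_two]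
    ring
  mul_ne_zero a b ha hb hab := by
    have da := (ρ a).2
    have db := (ρ b).2
    simp only [map_mul, Matrix.SpecialLinearGroup.coe_mul, Matrix.trace_fin_two, Matrix.mul_apply,
      Fin.sum_univ_two, Matrix.det_fin_two] at ha hb hab da db
    generalize (ρ a : Matrix (Fin 2) (Fin 2) ℝ) = A at *
    generalize (ρ b : Matrix (Fin 2) (Fin 2) ℝ) = B at *
    rw [eq_neg_of_add_eq_zero_right ha, eq_neg_of_add_eq_zero_right hb] at *
    have h₁ : A 0 1 * A 1 0 = -(1 + A 0 0 ^ 2) := by linarith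
    have h₂ : B 0 1 * B 1 0 = -(1 + B 0 0 ^ 2) := by linarith
    have h₃ : (A 0 1 * B 1 0) * (A 1 0 * B 0 1) = (1 + A 0 0 ^ 2) * (1 + B 0 0 ^ 2) := by
      linear_combination (B 0 1 * B 1 0) * h₁ - (1 + A 0 0 ^ 2) * h₂
    have h₄ : A 0 1 * B 1 0 + A 1 0 * B 0 1 = -2 * (A 0 0 * B 0 0) := by linarith
    nlinarith [sq_nonneg (A 0 1 * B 1 0 - A 1 0 * B 0 1), sq_nonneg (A 0 0), sq_nonneg (B 0 0),
      congrArg (· ^ 2) h₄]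

open Matrix in
/-- If `tr [A, B] ≠ 2` then `1, A, B, A * B` span the matrix algebra. -/
lemma exists_linear_combination_of_trace_commutator_ne_two (A B : SL(2, ℝ))
    (h : Matrix.trace ((A * B * A⁻¹ * B⁻¹ : SL(2, ℝ)) : Matrix (Fin 2) (Fin 2) ℝ) ≠ 2)
    (X : Matrix (Fin 2) (Fin 2) ℝ) :
    ∃ c : Fin 4 → ℝ, X = c 0 • 1 + c 1 • (A : Matrix (Fin 2) (Fin 2) ℝ) +
      c 2 • (B : Matrix (Fin 2) (Fin 2) ℝ) + c 3 • (A * B : Matrix (Fin 2) (Fin 2) ℝ) := by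
  have h : (A.1 * B.1 * A.1.adjugate * B.1.adjugate).trace ≠ 2 := h
  have dA := A.2
  have dB := B.2
  generalize (A : Matrix (Fin 2) (Fin 2) ℝ) = M at *
  generalize (B : Matrix (Fin 2) (Fin 2) ℝ) = N at *
  simp only [adjugate_fin_two, trace_fin_two, mul_apply, Fin.sum_univ_two, det_fin_two, of_apply,
    cons_val', cons_val_zero, cons_val_one, cons_val_fin_one] at h dA dB
  let P : Matrix (Fin 4) (Fin 4) ℝ :=
    !![1, M 0 0, N 0 0, (M * N) 0 0; 0, M 0 1, N 0 1, (M * N) 0 1;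
       0, M 1 0, N 1 0, (M * N) 1 0; 1, M 1 1, N 1 1, (M * N) 1 1]
  have hP : IsUnit P := by
    rw [isUnit_iff_isUnit_det, isUnit_iff_ne_zero]
    intro h0
    apply h
    simp [P, det_succ_row_zero, Fin.sum_univ_succ, mul_apply, Fin.succAbove] at h0
    linear_combination -h0 + 2 * (N 0 0 * N 1 1 - N 0 1 * N 1 0) * dA + 2 * dB
  obtain ⟨c, hc⟩ := mulVec_surjective_iff_isUnit.2 hP ![X 0 0, X 0 1, X 1 0, X 1 1]
  refine ⟨c, ?_⟩
  have := congrFun hc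
  simp only [Fin.forall_fin_succ, P, mulVec, dotProduct, Fin.sum_univ_four] at this
  ext i j
  fin_cases i <;> fin_cases j <;> simp at this ⊢ <;> linarith

/-- Automorphisms of the matrix algebra are inner. -/
lemma exists_conj_of_algEquiv (f : Matrix (Fin 2) (Fin 2) ℝ ≃ₐ[ℝ] Matrix (Fin 2) (Fin 2) ℝ) :
    ∃ g : GL (Fin 2) ℝ, ∀ X, f X = (g : Matrix (Fin 2) (Fin 2) ℝ) * X *
      ((g⁻¹ : GL (Fin 2) ℝ) : Matrix (Fin 2) (Fin 2) ℝ) := by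
  obtain ⟨T, hT⟩ := ((Matrix.toLinAlgEquiv'.symm.trans f).trans
    Matrix.toLinAlgEquiv').eq_linearEquivConjAlgEquiv
  refine ⟨Matrix.GeneralLinearGroup.toLin.symm (LinearMap.GeneralLinearGroup.ofLinearEquiv T),
    fun X => ?_⟩
  have := DFunLike.congr_fun hT (Matrix.toLinAlgEquiv' X)
  apply Matrix.toLinAlgEquiv'.injective
  rw [map_mul, map_mul]
  change _ = Matrix.toLinAlgEquiv' (Matrix.toLinAlgEquiv'.symm (T : (Fin 2 → ℝ) →ₗ[ℝ] Fin 2 → ℝ)) *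
    Matrix.toLinAlgEquiv' X *
    Matrix.toLinAlgEquiv' (Matrix.toLinAlgEquiv'.symm (T.symm : (Fin 2 → ℝ) →ₗ[ℝ] Fin 2 → ℝ))
  rw [AlgEquiv.apply_symm_apply, AlgEquiv.apply_symm_apply]
  simpa [LinearEquiv.conjAlgEquiv_apply, Module.End.mul_eq_comp, LinearMap.comp_assoc] using this

/-- Surjective algebra homomorphisms to a matrix algebra with the same trace are conjugate. -/
lemma exists_conj_of_trace_eq {R : Type*} [Ring R] [Algebra ℝ R]
    (φ ψ : R →ₐ[ℝ] Matrix (Fin 2) (Fin 2) ℝ)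
    (hφ : Function.Surjective φ) (hψ : Function.Surjective ψ)
    (h : ∀ x, (φ x).trace = (ψ x).trace) :
    ∃ g : GL (Fin 2) ℝ, ∀ x, φ x = (g : Matrix (Fin 2) (Fin 2) ℝ) * ψ x *
      ((g⁻¹ : GL (Fin 2) ℝ) : Matrix (Fin 2) (Fin 2) ℝ) := by
  have hker : RingHom.ker ψ = RingHom.ker φ := by
    ext x
    rw [RingHom.mem_ker, RingHom.mem_ker, Matrix.ext_iff_trace_mul_right,
      Matrix.ext_iff_trace_mul_right, hψ.forall, hφ.forall]
    simp only [zero_mul, ← map_mul, h]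
  obtain ⟨g, hg⟩ := exists_conj_of_algEquiv
    (((Ideal.quotientKerAlgEquivOfSurjective hψ).symm.trans
      (Ideal.quotientEquivAlgOfEq ℝ hker)).trans (Ideal.quotientKerAlgEquivOfSurjective hφ))
  refine ⟨g, fun x => ?_⟩
  rw [← hg, ← Ideal.quotientKerAlgEquivOfSurjective_mk hψ x]
  simp

/-- A rescaling of a non-elementary representation generates the matrix algebra. -/
lemma surjective_lift {Γ : Type*} [Group Γ] (ρ : Γ →* SL(2, ℝ)) (hρ : NonElementary ρ)
    (σ : Γ →* Matrix (Fin 2) (Fin 2) ℝ)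
    (hσ : ∀ γ, ∃ c : ℝ, (ρ γ : Matrix (Fin 2) (Fin 2) ℝ) = c • σ γ) :
    Function.Surjective (MonoidAlgebra.lift ℝ (Matrix (Fin 2) (Fin 2) ℝ) Γ σ) := by
  obtain ⟨a, b, hab⟩ := hρ
  intro X
  obtain ⟨c, hc⟩ := exists_linear_combination_of_trace_commutator_ne_two _ _ hab X
  have hmem : ∀ γ, (ρ γ : Matrix (Fin 2) (Fin 2) ℝ) ∈
      (MonoidAlgebra.lift ℝ (Matrix (Fin 2) (Fin 2) ℝ) Γ σ).range := by
    intro γ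
    obtain ⟨c, hc⟩ := hσ γ
    exact ⟨MonoidAlgebra.single γ c, by rw [hc]; simp⟩
  change X ∈ (MonoidAlgebra.lift ℝ (Matrix (Fin 2) (Fin 2) ℝ) Γ σ).range
  rw [hc]
  exact add_mem (add_mem (add_mem (Subalgebra.smul_mem _ (one_mem _) _)
    (Subalgebra.smul_mem _ (hmem a) _)) (Subalgebra.smul_mem _ (hmem b) _))
    (Subalgebra.smul_mem _ (mul_mem (hmem a) (hmem b)) _)

/-- The non-elementary case of Proposition 2.24 of the paper: two non-elementary
representations in `SL(2, ℝ)` with equal characters (in absolute value) are conjugate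
by an element of `GL(2, ℝ)`, up to sign. -/
theorem nonelementary_equal_characters_conjugate {Γ : Type*} [Group Γ]
    (ρ₁ ρ₂ : Γ →* Matrix.SpecialLinearGroup (Fin 2) ℝ)
    (h₁ : NonElementary ρ₁) (h₂ : NonElementary ρ₂)
    (htr : ∀ γ : Γ,
      |Matrix.trace ((ρ₁ γ : SL(2, ℝ)) : Matrix (Fin 2) (Fin 2) ℝ)| =
      |Matrix.trace ((ρ₂ γ : SL(2, ℝ)) : Matrix (Fin 2) (Fin 2) ℝ)|) :
    ∃ g : Matrix.GeneralLinearGroup (Fin 2) ℝ, ∀ γ : Γ,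
      ((ρ₁ γ : SL(2, ℝ)) : Matrix (Fin 2) (Fin 2) ℝ) =
          (g : Matrix (Fin 2) (Fin 2) ℝ) * ((ρ₂ γ : SL(2, ℝ)) : Matrix (Fin 2) (Fin 2) ℝ) *
            ((g⁻¹ : Matrix.GeneralLinearGroup (Fin 2) ℝ) : Matrix (Fin 2) (Fin 2) ℝ) ∨
      ((ρ₁ γ : SL(2, ℝ)) : Matrix (Fin 2) (Fin 2) ℝ) =
          -((g : Matrix (Fin 2) (Fin 2) ℝ) * ((ρ₂ γ : SL(2, ℝ)) : Matrix (Fin 2) (Fin 2) ℝ) *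
            ((g⁻¹ : Matrix.GeneralLinearGroup (Fin 2) ℝ) : Matrix (Fin 2) (Fin 2) ℝ)) := by
  obtain ⟨ε, hε⟩ := (isTraceFunction_trace ρ₁).exists_sign (isTraceFunction_trace ρ₂) htr
  let σ₁ : Γ →* Matrix (Fin 2) (Fin 2) ℝ := Matrix.SpecialLinearGroup.coeMonoidHom.comp ρ₁
  let σ₂ : Γ →* Matrix (Fin 2) (Fin 2) ℝ :=
    { toFun := fun γ => ε γ • (ρ₂ γ : Matrix (Fin 2) (Fin 2) ℝ)
      map_one' := by simp
      map_mul' := fun a b => by simp [smul_smul, mul_comm] }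
  have hσ₁ : ∀ γ, σ₁ γ = ρ₁ γ := fun γ => rfl
  have hσ₂ : ∀ γ, σ₂ γ = ε γ • (ρ₂ γ : Matrix (Fin 2) (Fin 2) ℝ) := fun γ => rfl
  obtain ⟨g, hg⟩ := exists_conj_of_trace_eq
    (MonoidAlgebra.lift ℝ (Matrix (Fin 2) (Fin 2) ℝ) Γ σ₁)
    (MonoidAlgebra.lift ℝ (Matrix (Fin 2) (Fin 2) ℝ) Γ σ₂)
    (surjective_lift ρ₁ h₁ σ₁ fun γ => ⟨1, by rw [hσ₁, one_smul]⟩)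
    (surjective_lift ρ₂ h₂ σ₂ fun γ => ⟨ε γ, by
      rw [hσ₂, smul_smul]
      rcases (hε γ).1 with h | h <;> simp [h]⟩)
    (fun x => by
      induction x using MonoidAlgebra.induction_on with
      | of γ => simpa [hσ₁, hσ₂] using (hε γ).2
      | add x y hx hy => simp only [map_add, Matrix.trace_add, hx, hy]
      | smul r x hx => simp only [map_smul, Matrix.trace_smul, hx])
  refine ⟨g, fun γ => ?_⟩
  have := hg (MonoidAlgebra.of ℝ Γ γ)
  simp only [MonoidAlgebra.lift_of, hσ₁, hσ₂] at this
  rw [this]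
  rcases (hε γ).1 with h | h <;> simp [h]
end

section
/- Let θ ∈ ℝ be such that θ/π is irrational, let A ∈ SL(2,ℝ) be the rotation matrix with rows (cos θ, −sin θ) and (sin θ, cos θ), and let B ∈ SL(2,ℝ) be arbitrary. Then the set {n : ℕ | 1/2 ≤ |Tr (Aⁿ * B)| ∧ |Tr (Aⁿ * B)| ≤ 3/2} is infinite. (The key trace estimate in the proof of Theorem 2.26 of the paper.) -/
open scoped MatrixGroups

open Filter Topology

/-- The multiples `n • θ`, `n → ∞`, accumulate at every angle when `θ / π` is irrational. -/
theorem Real.Angle.mapClusterPt_nsmul_of_irrational {θ : ℝ} (hθ : Irrational (θ / Real.pi))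
    (x : Real.Angle) : MapClusterPt x atTop (fun n : ℕ ↦ n • (θ : Real.Angle)) := by
  have : Fact (0 < 2 * Real.pi) := ⟨Real.two_pi_pos⟩
  have hirr : Irrational (θ / (2 * Real.pi)) := by
    have h := hθ.div_natCast (m := 2) two_ne_zero
    rwa [div_div, mul_comm, Nat.cast_ofNat] at h
  exact ((mapClusterPt_atTop_nsmul_tfae (G := AddCircle (2 * Real.pi)) x (θ : ℝ)).out 0 3).2
    (AddCircle.denseRange_zsmul_coe_iff.2 hirr x)

/-- A trigonometric wave of amplitude at least one takes the value one. -/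
theorem Real.exists_mul_cos_add_mul_sin_eq_one {p q : ℝ} (h : 1 ≤ p ^ 2 + q ^ 2) :
    ∃ x : ℝ, p * Real.cos x + q * Real.sin x = 1 := by
  set z : ℂ := ⟨p, q⟩
  have hc : ‖z‖ * Real.cos z.arg = p := Complex.norm_mul_cos_arg z
  have hs : ‖z‖ * Real.sin z.arg = q := Complex.norm_mul_sin_arg z
  have hmax : p * Real.cos z.arg + q * Real.sin z.arg = ‖z‖ := by
    rw [← hc, ← hs]
    linear_combination ‖z‖ * Real.sin_sq_add_cos_sq z.arg
  have hnorm : 1 ≤ ‖z‖ := by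
    have hsq : ‖z‖ ^ 2 = p ^ 2 + q ^ 2 := by
      rw [← hc, ← hs]
      linear_combination -‖z‖ ^ 2 * Real.sin_sq_add_cos_sq z.arg
    nlinarith [norm_nonneg z]
  have hcont : Continuous fun x : ℝ ↦ p * Real.cos x + q * Real.sin x := by fun_prop
  refine mem_range_of_exists_le_of_exists_ge hcont ⟨z.arg + Real.pi, ?_⟩ ⟨z.arg, ?_⟩
  · rw [Real.cos_add_pi, Real.sin_add_pi]
    linarith
  · linarith

/-- Powers of a rotation matrix rotate by multiples of the angle. -/
theorem Matrix.rotation_pow (θ : ℝ) (n : ℕ) :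
    !![Real.cos θ, -Real.sin θ; Real.sin θ, Real.cos θ] ^ n =
      !![Real.cos (n * θ), -Real.sin (n * θ); Real.sin (n * θ), Real.cos (n * θ)] := by
  induction n with
  | zero => simp [Matrix.one_fin_two]
  | succ n ih =>
    rw [pow_succ, ih, Matrix.mul_fin_two, Nat.cast_succ, add_one_mul, Real.cos_add, Real.sin_add]
    congr! 3 <;> ring_nf

/-- The key trace estimate from the proof of Theorem 2.26 of the paper: if `A` is a
rotation by an angle `θ` with `θ/π` irrational, then for any `B ∈ SL(2, ℝ)` there are
infinitely many `n` with `1/2 ≤ |Tr (Aⁿ B)| ≤ 3/2`. -/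
theorem infinitely_many_elliptic_products (θ : ℝ) (hθ : Irrational (θ / Real.pi))
    (A : SL(2, ℝ))
    (hA : (A : Matrix (Fin 2) (Fin 2) ℝ) =
      !![Real.cos θ, -Real.sin θ; Real.sin θ, Real.cos θ])
    (B : SL(2, ℝ)) :
    {n : ℕ |
      1 / 2 ≤ |Matrix.trace ((A ^ n * B : SL(2, ℝ)) : Matrix (Fin 2) (Fin 2) ℝ)| ∧
      |Matrix.trace ((A ^ n * B : SL(2, ℝ)) : Matrix (Fin 2) (Fin 2) ℝ)| ≤ 3 / 2}.Infinite := by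
  set p : ℝ := B 0 0 + B 1 1 with hp
  set q : ℝ := B 0 1 - B 1 0 with hq
  let f : Real.Angle → ℝ := fun x ↦ p * x.cos + q * x.sin
  have hf : Continuous f :=
    (continuous_const.mul Real.Angle.continuous_cos).add
      (continuous_const.mul Real.Angle.continuous_sin)
  have htrace (n : ℕ) : Matrix.trace ((A ^ n * B : SL(2, ℝ)) : Matrix (Fin 2) (Fin 2) ℝ) =
      f (n • (θ : Real.Angle)) := by
    have hcoe : n • (θ : Real.Angle) = ((n * θ : ℝ) : Real.Angle) := by
      rw [← nsmul_eq_mul, Real.Angle.coe_nsmul]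
    simp only [f, hcoe, Real.Angle.cos_coe, Real.Angle.sin_coe]
    rw [Matrix.SpecialLinearGroup.coe_mul, Matrix.SpecialLinearGroup.coe_pow, hA,
      Matrix.rotation_pow, Matrix.trace_fin_two, Matrix.mul_apply, Matrix.mul_apply]
    simp [Fin.sum_univ_two, hp, hq]
    ring
  obtain ⟨x, hx⟩ : ∃ x : ℝ, p * Real.cos x + q * Real.sin x = 1 := by
    apply Real.exists_mul_cos_add_mul_sin_eq_one
    have hdet := B.det_coe
    rw [Matrix.det_fin_two] at hdet
    nlinarith [sq_nonneg (B 0 0 - B 1 1), sq_nonneg (B 0 1 + B 1 0)]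
  have hfx : f x = 1 := hx
  have hnhds : ∀ᶠ y in 𝓝 (x : Real.Angle), 1 / 2 ≤ |f y| ∧ |f y| ≤ 3 / 2 :=
    hf.abs.continuousAt.eventually_mem
      (Icc_mem_nhds (by norm_num [hfx]) (by norm_num [hfx]))
  simp only [htrace]
  exact Nat.frequently_atTop_iff_infinite.1
    ((Real.Angle.mapClusterPt_nsmul_of_irrational hθ x).frequently hnhds)
end

section
/- Let A, B ∈ SL(2,ℝ) with |Tr B| > 2, and suppose it is not the case that (Tr A = 0 and A * B * A⁻¹ = B⁻¹). Then for every r ∈ ℝ there exists n : ℤ such that |Tr (A * B ^ n)| > r. (The core of Lemma 3.2 of the paper, 'lemtechoneend1': the traces Tr(A Bⁿ) are unbounded unless A is an order-two elliptic exchanging the two fixed points of the hyperbolic element B.) -/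
open scoped MatrixGroups

open Matrix in
/-- The trace identity `Tr (AB) + Tr (AB⁻¹) = Tr A · Tr B` in `SL(2, ℝ)`. -/
lemma trace_mul_add_trace_mul_inv (A B : SL(2, ℝ)) :
    trace ((A * B : SL(2, ℝ)) : Matrix (Fin 2) (Fin 2) ℝ) +
      trace ((A * B⁻¹ : SL(2, ℝ)) : Matrix (Fin 2) (Fin 2) ℝ) =
    trace (B : Matrix (Fin 2) (Fin 2) ℝ) * trace (A : Matrix (Fin 2) (Fin 2) ℝ) := by
  change trace ((A : Matrix (Fin 2) (Fin 2) ℝ) * (B : Matrix (Fin 2) (Fin 2) ℝ)) +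
    trace ((A : Matrix (Fin 2) (Fin 2) ℝ) * adjugate (B : Matrix (Fin 2) (Fin 2) ℝ)) = _
  rw [adjugate_fin_two]
  simp [trace_fin_two, mul_apply, Fin.sum_univ_two]
  ring

/-- An element of trace zero in `SL(2, ℝ)` squares to `-1`. -/
lemma mul_self_eq_neg_one_of_trace_eq_zero (A : SL(2, ℝ))
    (hA : Matrix.trace (A : Matrix (Fin 2) (Fin 2) ℝ) = 0) : A * A = -1 := by
  have hinv : A⁻¹ = -A := by
    rw [Matrix.trace_fin_two] at hA
    rw [Matrix.SpecialLinearGroup.SL2_inv_expl]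
    ext i j
    fin_cases i <;> fin_cases j <;> simp <;> linarith
  rw [← neg_neg (A * A), ← mul_neg, ← hinv, mul_inv_cancel]

/-- A bounded real bi-infinite sequence with `u (n + 1) + u (n - 1) = τ * u n` and `|τ| > 2`
vanishes. -/
lemma eq_zero_of_bounded_of_recurrence {u : ℤ → ℝ} {τ r : ℝ} (hτ : 2 < |τ|)
    (hu : ∀ n, u (n + 1) + u (n - 1) = τ * u n) (hr : ∀ n, |u n| ≤ r) (n : ℤ) : u n = 0 := by
  have hbdd : BddAbove (Set.range fun n => |u n|) := ⟨r, by rintro _ ⟨n, rfl⟩; exact hr n⟩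
  set M := ⨆ n, |u n|
  have hle : ∀ n, |u n| ≤ M := fun n => le_ciSup hbdd n
  have hM0 : 0 ≤ M := (abs_nonneg _).trans (hle 0)
  have hstep : M ≤ 2 * M / |τ| := ciSup_le fun n => by
    rw [le_div_iff₀ (by linarith), mul_comm, ← abs_mul, ← hu n]
    linarith [abs_add_le (u (n + 1)) (u (n - 1)), hle (n + 1), hle (n - 1)]
  rw [le_div_iff₀ (by linarith)] at hstep
  have hMz : M = 0 := by nlinarith
  exact abs_eq_zero.mp (le_antisymm (hMz ▸ hle n) (abs_nonneg _))

/-- The core of Lemma 3.2 of the paper (`lemtechoneend1`): if `B` is hyperbolic and `A` is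
not an order-two elliptic exchanging the two fixed points of `B` (equivalently, it is not
the case that `Tr A = 0` and `A B A⁻¹ = B⁻¹`), then the traces `Tr (A Bⁿ)`, `n ∈ ℤ`, are
unbounded. -/
theorem trace_unbounded_of_hyperbolic (A B : SL(2, ℝ))
    (hB : |Matrix.trace ((B : SL(2, ℝ)) : Matrix (Fin 2) (Fin 2) ℝ)| > 2)
    (hAB : ¬ (Matrix.trace ((A : SL(2, ℝ)) : Matrix (Fin 2) (Fin 2) ℝ) = 0 ∧
      A * B * A⁻¹ = B⁻¹)) :
    ∀ r : ℝ, ∃ n : ℤ,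
      |Matrix.trace ((A * B ^ n : SL(2, ℝ)) : Matrix (Fin 2) (Fin 2) ℝ)| > r := by
  intro r
  by_contra! h
  have hzero := eq_zero_of_bounded_of_recurrence
    (u := fun n : ℤ => Matrix.trace ((A * B ^ n : SL(2, ℝ)) : Matrix (Fin 2) (Fin 2) ℝ))
    hB (fun n => by
      have := trace_mul_add_trace_mul_inv (A * B ^ n) B
      rwa [mul_assoc, mul_assoc, ← zpow_add_one, ← zpow_sub_one] at this) h
  have hA : Matrix.trace (A : Matrix (Fin 2) (Fin 2) ℝ) = 0 := by simpa using hzero 0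
  have hAB1 : Matrix.trace ((A * B : SL(2, ℝ)) : Matrix (Fin 2) (Fin 2) ℝ) = 0 := by
    simpa using hzero 1
  refine hAB ⟨hA, ?_⟩
  have hAA := mul_self_eq_neg_one_of_trace_eq_zero A hA
  have hABAB := mul_self_eq_neg_one_of_trace_eq_zero (A * B) hAB1
  have hinv : A⁻¹ = -A := inv_eq_of_mul_eq_one_right (by rw [mul_neg, hAA, neg_neg])
  rw [hinv]
  refine eq_inv_of_mul_eq_one_left ?_
  rw [mul_neg, neg_mul, mul_assoc, hABAB, neg_neg]
end

section
/- Let A, B ∈ SL(2,ℝ) with |Tr A| < 2 and |Tr B| < 2 (two elliptic elements), and suppose A * B ≠ B * A. Then Tr (A * B * A⁻¹ * B⁻¹) > 2. (The fact, used in Step 2 of the proof of Proposition 3.2 of the paper, that the commutator of two non-commuting elliptic elements of SL(2,ℝ) is hyperbolic with trace greater than 2.) -/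
open scoped MatrixGroups

/-- The trace of the commutator of two elements of `SL(2, R)` is `2 - det (A * B - B * A)`. -/
theorem trace_commutator_eq {R : Type*} [CommRing R] (A B : SL(2, R)) :
    Matrix.trace ((A * B * A⁻¹ * B⁻¹ : SL(2, R)) : Matrix (Fin 2) (Fin 2) R) =
      2 - Matrix.det ((A : Matrix (Fin 2) (Fin 2) R) * (B : Matrix (Fin 2) (Fin 2) R) -
        (B : Matrix (Fin 2) (Fin 2) R) * (A : Matrix (Fin 2) (Fin 2) R)) := by
  have hA := A.det_coe
  have hB := B.det_coe
  rw [Matrix.det_fin_two] at hA hB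
  simp only [Matrix.SpecialLinearGroup.coe_mul, Matrix.SpecialLinearGroup.coe_inv,
    Matrix.adjugate_fin_two, Matrix.trace_fin_two, Matrix.det_fin_two, Matrix.mul_apply,
    Fin.sum_univ_two, Matrix.sub_apply, Matrix.of_apply, Matrix.cons_val', Matrix.cons_val_zero,
    Matrix.cons_val_one, Matrix.cons_val_fin_one]
  generalize (A : Matrix (Fin 2) (Fin 2) R) 0 0 = a at *
  generalize (A : Matrix (Fin 2) (Fin 2) R) 0 1 = b at *
  generalize (A : Matrix (Fin 2) (Fin 2) R) 1 0 = c at *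
  generalize (A : Matrix (Fin 2) (Fin 2) R) 1 1 = d at *
  generalize (B : Matrix (Fin 2) (Fin 2) R) 0 0 = e at *
  generalize (B : Matrix (Fin 2) (Fin 2) R) 0 1 = f at *
  generalize (B : Matrix (Fin 2) (Fin 2) R) 1 0 = g at *
  generalize (B : Matrix (Fin 2) (Fin 2) R) 1 1 = h at *
  linear_combination 2 * (e * h - f * g) * hA + 2 * hB

/-- A real `2 × 2` matrix with negative characteristic discriminant has a commutator of negative
determinant with every matrix it does not commute with. -/
theorem det_mul_sub_mul_neg (A B : Matrix (Fin 2) (Fin 2) ℝ)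
    (hA : A.trace ^ 2 < 4 * A.det) (hcomm : A * B ≠ B * A) :
    (A * B - B * A).det < 0 := by
  contrapose! hcomm
  rw [Matrix.trace_fin_two, Matrix.det_fin_two] at hA
  simp only [Matrix.det_fin_two, Matrix.sub_apply, Matrix.mul_apply, Fin.sum_univ_two] at hcomm
  suffices A 0 1 * B 1 0 = A 1 0 * B 0 1 ∧
      (A 0 0 - A 1 1) * B 0 1 = A 0 1 * (B 0 0 - B 1 1) ∧
      A 1 0 * (B 0 0 - B 1 1) = (A 0 0 - A 1 1) * B 1 0 by
    obtain ⟨h₁, h₂, h₃⟩ := this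
    ext i j
    fin_cases i <;> fin_cases j <;> simp [Matrix.mul_apply, Fin.sum_univ_two] <;> linarith
  generalize A 0 0 = a at *
  generalize A 0 1 = b at *
  generalize A 1 0 = c at *
  generalize A 1 1 = d at *
  generalize B 0 0 = e at *
  generalize B 0 1 = f at *
  generalize B 1 0 = g at *
  generalize B 1 1 = h at *
  have hb : b ≠ 0 := by
    rintro rfl
    nlinarith [sq_nonneg (a - d)]
  have hD : 0 < 4 * (a * d - b * c) - (a + d) ^ 2 := by linarith
  obtain ⟨U, hU⟩ : ∃ U, U = (a - d) * f - b * (e - h) := ⟨_, rfl⟩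
  obtain ⟨M, hM⟩ : ∃ M, M = b * g - c * f := ⟨_, rfl⟩
  have key : (2 * b * M - (a - d) * U) ^ 2 + (4 * (a * d - b * c) - (a + d) ^ 2) * U ^ 2 ≤ 0 := by
    have := mul_nonneg (sq_nonneg b) hcomm
    subst hU hM
    linarith
  have hU0 : U = 0 := by
    have : (4 * (a * d - b * c) - (a + d) ^ 2) * U ^ 2 ≤ 0 := by
      linarith [sq_nonneg (2 * b * M - (a - d) * U)]
    exact pow_eq_zero_iff two_ne_zero |>.1 (le_antisymm (by nlinarith) (sq_nonneg U))
  have hM0 : M = 0 := by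
    have : (b * M) ^ 2 = 0 := le_antisymm (by rw [hU0] at key; linarith) (sq_nonneg _)
    simpa [hb] using this
  rw [hU0] at hU
  rw [hM0] at hM
  refine ⟨by linarith, by linarith, mul_left_cancel₀ hb ?_⟩
  linear_combination c * hU + (a - d) * hM

/-- The fact, used in Step 2 of the proof of Proposition 3.2 of the paper, that the
commutator of two non-commuting elliptic elements of `SL(2, ℝ)` is hyperbolic, with trace
strictly greater than 2. -/
theorem commutator_of_elliptics_hyperbolic (A B : SL(2, ℝ))
    (hA : |Matrix.trace ((A : SL(2, ℝ)) : Matrix (Fin 2) (Fin 2) ℝ)| < 2)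
    (hB : |Matrix.trace ((B : SL(2, ℝ)) : Matrix (Fin 2) (Fin 2) ℝ)| < 2)
    (hcomm : A * B ≠ B * A) :
    Matrix.trace ((A * B * A⁻¹ * B⁻¹ : SL(2, ℝ)) : Matrix (Fin 2) (Fin 2) ℝ) > 2 := by
  have hdisc : (A : Matrix (Fin 2) (Fin 2) ℝ).trace ^ 2 <
      4 * (A : Matrix (Fin 2) (Fin 2) ℝ).det := by
    rw [A.det_coe]
    nlinarith [abs_lt.1 hA]
  have hne : (A : Matrix (Fin 2) (Fin 2) ℝ) * (B : Matrix (Fin 2) (Fin 2) ℝ) ≠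
      (B : Matrix (Fin 2) (Fin 2) ℝ) * (A : Matrix (Fin 2) (Fin 2) ℝ) := fun h =>
    hcomm (Subtype.ext (by simpa using h))
  rw [trace_commutator_eq]
  linarith [det_mul_sub_mul_neg _ _ hdisc hne]
end

section
/- Let B, U ∈ SL(2,ℝ) with |Tr B| < 2 (B elliptic) and |Tr U| > 2 (U hyperbolic). Then Tr (B * U * B⁻¹ * U⁻¹) > 2. (The fact, used in the proof of Lemma 3.3 of the paper, that the commutator of an elliptic and a hyperbolic element of SL(2,ℝ) has trace strictly greater than 2; note that such a pair never commutes, since the centralizer of a hyperbolic element contains only elements of trace of absolute value at least 2.) -/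
open scoped MatrixGroups

/-- The Fricke trace identity, with the square in the trace of the product completed. -/
theorem Matrix.SpecialLinearGroup.trace_commutator_sub_two (B U : SL(2, ℝ)) :
    Matrix.trace ((B * U * B⁻¹ * U⁻¹ : SL(2, ℝ)) : Matrix (Fin 2) (Fin 2) ℝ) - 2 =
      (Matrix.trace (B * U : Matrix (Fin 2) (Fin 2) ℝ) -
          Matrix.trace (B : Matrix (Fin 2) (Fin 2) ℝ) *
            Matrix.trace (U : Matrix (Fin 2) (Fin 2) ℝ) / 2) ^ 2 +
        (4 - Matrix.trace (B : Matrix (Fin 2) (Fin 2) ℝ) ^ 2) *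
          (Matrix.trace (U : Matrix (Fin 2) (Fin 2) ℝ) ^ 2 - 4) / 4 := by
  have hB := B.det_coe
  have hU := U.det_coe
  rw [Matrix.det_fin_two] at hB hU
  simp only [Matrix.SpecialLinearGroup.coe_mul, Matrix.SpecialLinearGroup.coe_inv,
    Matrix.adjugate_fin_two, Matrix.trace_fin_two, Matrix.mul_apply, Fin.sum_univ_two,
    Matrix.of_apply, Matrix.cons_val_zero, Matrix.cons_val_one, Matrix.cons_val']
  generalize (B : Matrix (Fin 2) (Fin 2) ℝ) 0 0 = a at *
  generalize (B : Matrix (Fin 2) (Fin 2) ℝ) 0 1 = b at *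
  generalize (B : Matrix (Fin 2) (Fin 2) ℝ) 1 0 = c at *
  generalize (B : Matrix (Fin 2) (Fin 2) ℝ) 1 1 = d at *
  generalize (U : Matrix (Fin 2) (Fin 2) ℝ) 0 0 = e at *
  generalize (U : Matrix (Fin 2) (Fin 2) ℝ) 0 1 = f at *
  generalize (U : Matrix (Fin 2) (Fin 2) ℝ) 1 0 = g at *
  generalize (U : Matrix (Fin 2) (Fin 2) ℝ) 1 1 = h at *
  grind

/-- The fact, used in the proof of Lemma 3.3 of the paper, that the commutator of an
elliptic element and a hyperbolic element of `SL(2, ℝ)` has trace strictly greater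
than 2. -/
theorem commutator_elliptic_hyperbolic (B U : SL(2, ℝ))
    (hB : |Matrix.trace ((B : SL(2, ℝ)) : Matrix (Fin 2) (Fin 2) ℝ)| < 2)
    (hU : |Matrix.trace ((U : SL(2, ℝ)) : Matrix (Fin 2) (Fin 2) ℝ)| > 2) :
    Matrix.trace ((B * U * B⁻¹ * U⁻¹ : SL(2, ℝ)) : Matrix (Fin 2) (Fin 2) ℝ) > 2 := by
  have hB' : 0 < 4 - Matrix.trace (B : Matrix (Fin 2) (Fin 2) ℝ) ^ 2 := by
    rw [← sq_abs]
    nlinarith [abs_nonneg (Matrix.trace (B : Matrix (Fin 2) (Fin 2) ℝ))]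
  have hU' : 0 < Matrix.trace (U : Matrix (Fin 2) (Fin 2) ℝ) ^ 2 - 4 := by
    rw [← sq_abs]
    nlinarith
  rw [gt_iff_lt, ← sub_pos, Matrix.SpecialLinearGroup.trace_commutator_sub_two]
  positivity
end

section
/- Let X be a type with a total cyclic order and x₀ ∈ X. Let F : ℤ × X → ℤ × X be a bijection that projects to the identity of X and is increasing for <ₓ₀. Then there exists n : ℤ such that F = hⁿ, i.e. F (m, x) = (m + n, x) for all (m, x) ∈ ℤ × X. (Proposition 2.17 of the paper, 'uniqueh'.) -/
/-- The relation `x ≺ y` on `X` relative to a base point `x₀`: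
`x ≺ y` iff (`x = x₀` and `y ≠ x₀`) or `sbtw x₀ x y`. -/
def Prec {X : Type*} [CircularOrder X] (x₀ x y : X) : Prop :=
  (x = x₀ ∧ y ≠ x₀) ∨ sbtw x₀ x y

/-- The strict order `<ₓ₀` on `ℤ × X`. -/
def LtZX {X : Type*} [CircularOrder X] (x₀ : X) (a b : ℤ × X) : Prop :=
  a.1 < b.1 ∨ (a.1 = b.1 ∧ Prec x₀ a.2 b.2)

/-- A map of `ℤ × X` projects to a map `f` of `X`. -/
def Projects {X : Type*} (F : ℤ × X → ℤ × X) (f : X → X) : Prop :=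
  Prod.snd ∘ F = f ∘ Prod.snd

/-- A map of `ℤ × X` is increasing for the order `<ₓ₀`. -/
def IncreasingZX {X : Type*} [CircularOrder X] (x₀ : X) (F : ℤ × X → ℤ × X) : Prop :=
  ∀ a b : ℤ × X, LtZX x₀ a b → LtZX x₀ (F a) (F b)

theorem StrictMono.int_eq_add_of_surjective {g : ℤ → ℤ} (hg : StrictMono g)
    (hs : Function.Surjective g) (m : ℤ) : g m = m + g 0 := by
  have succ (k : ℤ) : g (k + 1) = g k + 1 := by
    obtain ⟨l, hl⟩ := hs (g k + 1)
    have hkl : k < l := hg.lt_iff_lt.1 (by lia)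
    have hle : g (k + 1) ≤ g l := hg.monotone hkl
    have hlt : g k < g (k + 1) := hg (lt_add_one k)
    lia
  induction m using Int.induction_on with
  | zero => simp
  | succ i ih => rw [succ, ih]; ring
  | pred i ih =>
    have h := succ (-(i : ℤ) - 1)
    rw [sub_add_cancel, ih] at h
    lia

theorem not_prec_self {X : Type*} [CircularOrder X] (x₀ x : X) : ¬ Prec x₀ x x := by
  rintro (⟨h, h'⟩ | h)
  · exact h' h
  · exact sbtw_irrefl_right h

theorem not_prec_base {X : Type*} [CircularOrder X] (x₀ x : X) : ¬ Prec x₀ x x₀ := by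
  rintro (⟨-, h⟩ | h)
  · exact h rfl
  · exact sbtw_irrefl_left_right h

theorem lift_id_apply_eq_add {X : Type*} [CircularOrder X] {x₀ : X}
    {F : ℤ × X → ℤ × X} (hsurj : Function.Surjective F)
    (hsnd : ∀ p, (F p).2 = p.2) (hinc : IncreasingZX x₀ F) (m : ℤ) (x : X) :
    (F (m, x)).1 = m + (F (0, x)).1 := by
  refine StrictMono.int_eq_add_of_surjective (g := fun k => (F (k, x)).1) ?_ ?_ m
  · intro k l hkl
    rcases hinc (k, x) (l, x) (Or.inl hkl) with h | ⟨-, h⟩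
    · exact h
    · rw [hsnd, hsnd] at h
      exact absurd h (not_prec_self x₀ x)
  · intro k
    obtain ⟨⟨l, y⟩, hl⟩ := hsurj (k, x)
    obtain rfl : y = x := by simpa [hl] using (hsnd (l, y)).symm
    exact ⟨l, by simp [hl]⟩

/-- Proposition 2.17 of the paper (`uniqueh`): a bijection of `ℤ × X` which projects to
the identity of `X` and is increasing for `<ₓ₀` is a power of the shift
`h : (n, x) ↦ (n + 1, x)`. -/
theorem lift_of_id_is_power_of_shift {X : Type*} [CircularOrder X] (x₀ : X)
    (F : ℤ × X → ℤ × X) (hbij : Function.Bijective F)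
    (hproj : Projects F id) (hinc : IncreasingZX x₀ F) :
    ∃ n : ℤ, ∀ p : ℤ × X, F p = (p.1 + n, p.2) := by
  have hsnd (p : ℤ × X) : (F p).2 = p.2 := congrFun hproj p
  have hadd := lift_id_apply_eq_add hbij.surjective hsnd hinc
  refine ⟨(F (0, x₀)).1, fun ⟨m, x⟩ => Prod.ext ?_ (hsnd _)⟩
  rw [hadd]
  congr 1
  by_cases hx : x = x₀
  · rw [hx]
  apply le_antisymm
  · rcases hinc (0, x) (1, x₀) (Or.inl zero_lt_one) with h | ⟨-, h⟩
    · rw [hadd 1 x₀] at h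
      lia
    · rw [hsnd, hsnd] at h
      exact absurd h (not_prec_base x₀ x)
  · rcases hinc (0, x₀) (0, x) (Or.inr ⟨rfl, Or.inl ⟨rfl, hx⟩⟩) with h | ⟨h, -⟩
    · exact h.le
    · exact h.le
end

section
/- Let X be a type with a total cyclic order and x₀ ∈ X. Every order-preserving bijection f of X admits a lift to ℤ × X; moreover, if F and F' are two lifts of f, then there exists n : ℤ such that F' = hⁿ ∘ F. (The lifting proposition of Section 2.3.2 of the paper.) -/
/-- A lift of an order-preserving bijection `f` of `X`: a bijection of `ℤ × X` that
projects to `f` and is increasing for `<ₓ₀`. -/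
def IsLift {X : Type*} [CircularOrder X] (x₀ : X) (f : X → X) (F : ℤ × X → ℤ × X) : Prop :=
  Function.Bijective F ∧ Projects F f ∧ IncreasingZX x₀ F

section Prec

variable {X : Type*} [CircularOrder X] {x₀ x y z : X}

theorem Prec.ne_base (h : Prec x₀ x y) : y ≠ x₀ := by
  rintro rfl
  rcases h with ⟨_, h⟩ | h
  · exact h rfl
  · exact sbtw_irrefl_left_right h

theorem Prec.irrefl : ¬ Prec x₀ x x := by
  rintro (⟨h, h'⟩ | h)
  · exact h' h
  · exact sbtw_irrefl_right h

theorem Prec.trans (h : Prec x₀ x y) (h' : Prec x₀ y z) : Prec x₀ x z := by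
  rcases h with ⟨rfl, _⟩ | hxy
  · exact Or.inl ⟨rfl, h'.ne_base⟩
  · rcases h' with ⟨rfl, _⟩ | hyz
    · exact (sbtw_irrefl_left_right hxy).elim
    · exact Or.inr (hxy.trans_right hyz)

theorem Prec.trichotomy (x₀ x y : X) : Prec x₀ x y ∨ x = y ∨ Prec x₀ y x := by
  by_cases hxy : x = y
  · exact Or.inr (Or.inl hxy)
  by_cases hx : x = x₀
  · exact Or.inl (Or.inl ⟨hx, fun hy => hxy (hx.trans hy.symm)⟩)
  by_cases hy : y = x₀
  · exact Or.inr (Or.inr (Or.inl ⟨hy, hx⟩))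
  by_cases h : sbtw x₀ x y
  · exact Or.inl (Or.inr h)
  · refine Or.inr (Or.inr (Or.inr ?_))
    have h₁ : btw y x x₀ := btw_iff_not_sbtw.2 h
    refine h₁.cyclic_right.sbtw_of_not_btw fun h₂ => ?_
    rcases h₁.antisymm h₂.cyclic_right with h | h | h
    exacts [hxy h.symm, hx h, hy h.symm]

theorem Prec.sbtw (h : Prec x₀ x y) (h' : Prec x₀ y z) : sbtw x y z := by
  rcases h' with ⟨hy, _⟩ | hyz
  · exact (h.ne_base hy).elim
  · rcases h with ⟨rfl, _⟩ | hxy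
    · exact hyz
    · exact (hyz.cyclic_left.trans_right hxy.cyclic_right).cyclic_right

/-- A cyclically ordered triple is increasing for `Prec x₀` up to a cyclic rotation. -/
theorem Prec.of_sbtw (x₀ : X) (h : SBtw.sbtw x y z) :
    (Prec x₀ x y ∧ Prec x₀ y z) ∨ (Prec x₀ y z ∧ Prec x₀ z x) ∨
      (Prec x₀ z x ∧ Prec x₀ x y) := by
  have h₁ : ¬ (Prec x₀ x z ∧ Prec x₀ z y) := fun k =>
    h.not_sbtw (k.1.sbtw k.2).cyclic_left
  have h₂ : ¬ (Prec x₀ z y ∧ Prec x₀ y x) := fun k => h.not_sbtw (k.1.sbtw k.2)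
  have h₃ : ¬ (Prec x₀ y x ∧ Prec x₀ x z) := fun k =>
    h.not_sbtw (k.1.sbtw k.2).cyclic_right
  rcases Prec.trichotomy x₀ x y with hxy | rfl | hxy
  · rcases Prec.trichotomy x₀ y z with hyz | rfl | hyz
    · tauto
    · exact (sbtw_irrefl_right h).elim
    · rcases Prec.trichotomy x₀ z x with hzx | rfl | hzx
      · tauto
      · exact (sbtw_irrefl_left_right h).elim
      · tauto
  · exact (sbtw_irrefl_left h).elim
  · rcases Prec.trichotomy x₀ y z with hyz | rfl | hyz
    · rcases Prec.trichotomy x₀ z x with hzx | rfl | hzx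
      · tauto
      · exact (sbtw_irrefl_left_right h).elim
      · tauto
    · exact (sbtw_irrefl_right h).elim
    · tauto

end Prec

theorem StrictMono.int_eq_add_of_surjective_s12 {k : ℤ → ℤ} (hk : StrictMono k)
    (hs : Function.Surjective k) (n : ℤ) : k n = n + k 0 := by
  have succ (n : ℤ) : k (n + 1) = k n + 1 := by
    obtain ⟨m, hm⟩ := hs (k n + 1)
    have h₁ : n < m := hk.lt_iff_lt.1 (by omega)
    have h₂ : k n < k (n + 1) := hk (by omega)
    have h₃ : k (n + 1) ≤ k m := hk.monotone (by omega)
    omega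
  induction n using Int.induction_on with
  | zero => simp
  | succ i ih => rw [succ, ih]; ring
  | pred i ih =>
    have := succ (-(i : ℤ) - 1)
    rw [sub_add_cancel] at this
    omega

section Lift

variable {X : Type*} [CircularOrder X] {x₀ : X} {f : X → X}

/-- A lift of an injective map acts on each fibre of `ℤ × X → X` as a translation. -/
theorem IsLift.apply_eq {F : ℤ × X → ℤ × X} (hF : IsLift x₀ f F) (hf : Function.Injective f)
    (n : ℤ) (x : X) : F (n, x) = (n + (F (0, x)).1, f x) := by
  obtain ⟨hbij, hproj, hinc⟩ := hF
  have hsnd (p : ℤ × X) : (F p).2 = f p.2 := congrFun hproj p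
  refine Prod.ext ?_ (hsnd _)
  refine StrictMono.int_eq_add_of_surjective_s12 (k := fun n => (F (n, x)).1) ?_ ?_ n
  · intro a b hab
    rcases hinc (a, x) (b, x) (Or.inl hab) with h | ⟨_, h⟩
    · exact h
    · rw [hsnd, hsnd] at h
      exact (Prec.irrefl h).elim
  · intro j
    obtain ⟨⟨m, z⟩, hm⟩ := hbij.2 (j, f x)
    have hz : f z = f x := by rw [← hsnd (m, z), hm]
    obtain rfl := hf hz
    exact ⟨m, congrArg Prod.fst hm⟩

open Classical in
/-- The translation number of a lift on the fibre over `y`, relative to the one over `x₀`. -/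
theorem IsLift.fst_eq {F : ℤ × X → ℤ × X} (hF : IsLift x₀ f F) (hf : Function.Injective f)
    (y : X) :
    (F (0, y)).1 = (F (0, x₀)).1 + if Prec x₀ (f y) (f x₀) then 1 else 0 := by
  by_cases hy : y = x₀
  · subst hy
    simp [Prec.irrefl]
  have h₁ := hF.2.2 (0, x₀) (0, y) (Or.inr ⟨rfl, Or.inl ⟨rfl, hy⟩⟩)
  have h₂ := hF.2.2 (0, y) (1, x₀) (Or.inl zero_lt_one)
  rw [hF.apply_eq hf 0 x₀, hF.apply_eq hf 0 y] at h₁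
  rw [hF.apply_eq hf 0 y, hF.apply_eq hf 1 x₀] at h₂
  simp only [LtZX, zero_add] at h₁ h₂
  split_ifs with h
  · have : ¬ Prec x₀ (f x₀) (f y) := fun h' => Prec.irrefl (h.trans h')
    simp only [this, and_false, or_false] at h₁
    omega
  · simp only [h, and_false, or_false] at h₂
    omega

open Classical in
/-- The lift of `f` sending `(0, x₀)` to `(0, f x₀)`. -/
noncomputable def baseLift (x₀ : X) (f : X → X) (p : ℤ × X) : ℤ × X :=
  (p.1 + if Prec x₀ (f p.2) (f x₀) then 1 else 0, f p.2)

theorem increasingZX_baseLift (hf : Function.Injective f)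
    (hord : ∀ a b c : X, sbtw a b c → sbtw (f a) (f b) (f c)) :
    IncreasingZX x₀ (baseLift x₀ f) := by
  rintro ⟨m, x⟩ ⟨n, y⟩ h
  have trans {a b c : X} : Prec x₀ a b → Prec x₀ b c → Prec x₀ a c := Prec.trans
  have irrefl {a : X} : ¬ Prec x₀ a a := Prec.irrefl
  have tri := Prec.trichotomy x₀ (f x₀) (f y)
  simp only [LtZX, baseLift] at h ⊢
  rcases h with h | ⟨rfl, ⟨rfl, hy⟩ | h⟩
  · split_ifs with hx hy
    · left; omega
    · have : Prec x₀ (f x) (f y) := by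
        rcases tri with t | t | t
        · exact hx.trans t
        · exact t ▸ hx
        · exact (hy t).elim
      rcases (Int.add_one_le_iff.2 h).lt_or_eq with h | h
      · left; omega
      · right; exact ⟨by omega, this⟩
    · left; omega
    · left; omega
  · have hy' : f x ≠ f y := fun e => hy (hf e.symm)
    split_ifs <;> grind
  · have := Prec.of_sbtw x₀ (hord _ _ _ h)
    split_ifs <;> grind

theorem isLift_baseLift (hbij : Function.Bijective f)
    (hord : ∀ a b c : X, sbtw a b c → sbtw (f a) (f b) (f c)) :
    IsLift x₀ f (baseLift x₀ f) := by
  refine ⟨⟨?_, ?_⟩, rfl, increasingZX_baseLift hbij.1 hord⟩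
  · rintro ⟨m, x⟩ ⟨n, y⟩ h
    simp only [baseLift, Prod.mk.injEq] at h
    obtain ⟨h, hxy⟩ := h
    obtain rfl := hbij.1 hxy
    rw [add_right_cancel h]
  · rintro ⟨n, y⟩
    obtain ⟨x, rfl⟩ := hbij.2 y
    classical
    exact ⟨(n - if Prec x₀ (f x) (f x₀) then 1 else 0, x), by simp [baseLift]⟩

end Lift

/-- The lifting proposition of Section 2.3.2 of the paper: every order-preserving
bijection `f` of a cyclically ordered set `X` admits a lift to `ℤ × X`, and any two lifts
differ by a power of the shift `h : (n, x) ↦ (n + 1, x)`. -/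
theorem lift_exists_and_unique_up_to_shift {X : Type*} [CircularOrder X] (x₀ : X)
    (f : X → X) (hbij : Function.Bijective f)
    (hord : ∀ a b c : X, sbtw a b c → sbtw (f a) (f b) (f c)) :
    (∃ F : ℤ × X → ℤ × X, IsLift x₀ f F) ∧
    ∀ F F' : ℤ × X → ℤ × X, IsLift x₀ f F → IsLift x₀ f F' →
      ∃ n : ℤ, ∀ p : ℤ × X, F' p = ((F p).1 + n, (F p).2) := by
  refine ⟨⟨baseLift x₀ f, isLift_baseLift hbij hord⟩, fun F F' hF hF' =>
    ⟨(F' (0, x₀)).1 - (F (0, x₀)).1, ?_⟩⟩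
  rintro ⟨m, y⟩
  rw [hF.apply_eq hbij.1 m y, hF'.apply_eq hbij.1 m y, hF.fst_eq hbij.1 y, hF'.fst_eq hbij.1 y]
  ext
  · simp only
    ring
  · rfl
end
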